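/- arXiv:1402.4635 — 3 statements merged into one kernel-verified Lean document; each statement's English description precedes it below -/
import Mathlib

section
/- There exist real constants η > 0 and B > 0 such that for every g ∈ Sp₄(ℝ) and every ε > 0 there is a constant C = C(g,ε) > 0 with the following property: for every positive integer m and every real δ with 0 < δ ≤ 1, the set 𝒮(g)_δ[m] is finite and its cardinality is at most C · m^(1+ε) · (1 + δ^η · m^B). -/
open Matrix

noncomputable section

/-- The standard symplectic form matrix `J = ((0, I₂), (−I₂, 0))`. -/
def Jmat : Matrix (Fin 4) (Fin 4) ℝ := !![0, 0, 1, 0; 0, 0, 0, 1; -1, 0, 0, 0; 0, -1, 0, 0]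

/-- `Sp₄(ℝ)`: real matrices with `Mᵀ J M = J`. -/
def Sp4 : Set (Matrix (Fin 4) (Fin 4) ℝ) := {M | Mᵀ * Jmat * M = Jmat}

/-- `S(m)`: integral matrices with `Mᵀ J M = m·J`. -/
def Smat (m : ℕ) : Set (Matrix (Fin 4) (Fin 4) ℤ) :=
  {M | (M.map (Int.cast : ℤ → ℝ))ᵀ * Jmat * (M.map (Int.cast : ℤ → ℝ)) = (m : ℝ) • Jmat}

/-- `K = Sp₄(ℝ) ∩ O(4)`. -/
def Ksp : Set (Matrix (Fin 4) (Fin 4) ℝ) := {k | k ∈ Sp4 ∧ kᵀ * k = 1}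

/-- `𝒮(g)_δ[m]`: the elements `γ ∈ S(m)` with `m^(−1/2) γ` within `δ` (entrywise)
of `g K g⁻¹`. -/
def Sball (g : Matrix (Fin 4) (Fin 4) ℝ) (δ : ℝ) (m : ℕ) :
    Set (Matrix (Fin 4) (Fin 4) ℤ) :=
  {γ | γ ∈ Smat m ∧ ∃ k ∈ Ksp, ∀ i j,
    |(m : ℝ) ^ (-(1 : ℝ)/2) * (γ.map (Int.cast : ℤ → ℝ)) i j - (g * k * g⁻¹) i j| ≤ δ}

/-- The divisor bound: `d(n) ≪ n ^ ε`. -/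
theorem exists_card_divisors_le_rpow {ε : ℝ} (hε : 0 < ε) :
    ∃ C : ℝ, 1 ≤ C ∧ ∀ n : ℕ, n ≠ 0 → (n.divisors.card : ℝ) ≤ C * (n : ℝ) ^ ε := by
  have hlog : 0 < ε * Real.log 2 := mul_pos hε (Real.log_pos one_lt_two)
  set K : ℝ := 1 + 1 / (ε * Real.log 2) with hK
  have hK1 : 1 ≤ K := by rw [hK]; linarith [one_div_pos.mpr hlog]
  obtain ⟨L, hL⟩ := exists_nat_ge ((2 : ℝ) ^ (1 / ε))
  refine ⟨K ^ L, one_le_pow₀ hK1, fun n hn => ?_⟩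
  have key : ∀ p ∈ n.primeFactors, ((n.factorization p + 1 : ℕ) : ℝ) ≤
      (if p < L then K else 1) * (((p : ℝ) ^ n.factorization p) ^ ε) := by
    intro p hp
    have hp2 : (2 : ℝ) ≤ p := by exact_mod_cast (Nat.prime_of_mem_primeFactors hp).two_le
    set e := n.factorization p
    have hcomm : ((p : ℝ) ^ e) ^ ε = ((p : ℝ) ^ ε) ^ e := by
      rw [← Real.rpow_natCast, ← Real.rpow_natCast, ← Real.rpow_mul (by linarith),
        ← Real.rpow_mul (by linarith), mul_comm]
    rw [hcomm]
    split_ifs with h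
    · have h1 : 1 + ε * Real.log 2 ≤ (p : ℝ) ^ ε := by
        calc 1 + ε * Real.log 2 ≤ Real.exp (ε * Real.log 2) := by
              linarith [Real.add_one_le_exp (ε * Real.log 2)]
          _ = (2 : ℝ) ^ ε := by rw [Real.rpow_def_of_pos two_pos, mul_comm]
          _ ≤ (p : ℝ) ^ ε := Real.rpow_le_rpow two_pos.le hp2 hε.le
      have h2 : 1 + (e : ℝ) * (ε * Real.log 2) ≤ ((p : ℝ) ^ ε) ^ e :=
        (one_add_mul_le_pow (by linarith) e).trans (pow_le_pow_left₀ (by linarith) h1 e)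
      calc ((e + 1 : ℕ) : ℝ) ≤ K * (1 + (e : ℝ) * (ε * Real.log 2)) := by
            rw [hK]
            have : (1 + 1 / (ε * Real.log 2)) * (1 + (e : ℝ) * (ε * Real.log 2))
              = 1 + e + (e : ℝ) * (ε * Real.log 2) + 1 / (ε * Real.log 2) := by
              field_simp
              ring
            rw [this]
            push_cast
            have := one_div_pos.mpr hlog
            have : 0 ≤ (e : ℝ) * (ε * Real.log 2) := by positivity
            linarith
        _ ≤ _ := by gcongr
    · have h1 : (2 : ℝ) ≤ (p : ℝ) ^ ε := by
        calc (2 : ℝ) = ((2 : ℝ) ^ (1 / ε)) ^ ε := by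
              rw [← Real.rpow_mul two_pos.le, one_div_mul_cancel hε.ne', Real.rpow_one]
          _ ≤ _ := by
              have : (L : ℝ) ≤ p := by exact_mod_cast not_lt.mp h
              exact Real.rpow_le_rpow (by positivity) (hL.trans this) hε.le
      calc ((e + 1 : ℕ) : ℝ) ≤ (2 : ℝ) ^ e := by exact_mod_cast Nat.lt_two_pow_self
        _ ≤ ((p : ℝ) ^ ε) ^ e := pow_le_pow_left₀ two_pos.le h1 e
        _ = _ := (one_mul _).symm
  have hprod : (n : ℝ) ^ ε = ∏ p ∈ n.primeFactors, ((p : ℝ) ^ n.factorization p) ^ ε := by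
    rw [Real.finsetProd_rpow _ _ (fun _ _ => by positivity)]
    congr 1
    conv_lhs => rw [← Nat.prod_factorization_pow_eq_self hn]
    simp [Finsupp.prod]
  rw [Nat.card_divisors hn, hprod, Nat.cast_prod]
  refine (Finset.prod_le_prod (fun _ _ => by positivity) key).trans ?_
  rw [Finset.prod_mul_distrib]
  refine mul_le_mul_of_nonneg_right ?_ (Finset.prod_nonneg fun _ _ => by positivity)
  rw [Finset.prod_ite]
  simp only [Finset.prod_const, one_pow, mul_one]
  refine pow_le_pow_right₀ hK1 ?_
  calc _ ≤ (Finset.range L).card := Finset.card_le_card (fun p hp => by simp_all)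
    _ = L := Finset.card_range L

theorem Int.dvd_two_of_sq_dvd_four_mul_squarefree {c D : ℤ} (hD : Squarefree D)
    (h : c ^ 2 ∣ 4 * D) : c ∣ 2 := by
  have hg : 0 < Int.gcd c 2 := Int.gcd_pos_of_ne_zero_right _ two_ne_zero
  obtain ⟨c', h', hcop, hc, h2⟩ := Int.exists_gcd_one hg
  set q : ℤ := (Int.gcd c 2 : ℤ) with hq
  have hq0 : q ≠ 0 := by positivity
  have h3 : c' ^ 2 ∣ h' ^ 2 * D := by
    have : q ^ 2 * c' ^ 2 ∣ q ^ 2 * (h' ^ 2 * D) := by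
      have e1 : q ^ 2 * c' ^ 2 = c ^ 2 := by rw [hc]; ring
      have e2 : q ^ 2 * (h' ^ 2 * D) = 4 * D := by
        have : (4 : ℤ) = (h' * q) ^ 2 := by rw [← h2]; norm_num
        rw [this]; ring
      rwa [e1, e2]
    exact Int.dvd_of_mul_dvd_mul_left (pow_ne_zero 2 hq0) this
  have hcop' : IsCoprime c' h' := Int.isCoprime_iff_gcd_eq_one.mpr hcop
  have h4 : c' ^ 2 ∣ D := (hcop'.pow).dvd_of_dvd_mul_left h3
  have h5 : IsUnit c' := hD c' (by rwa [← sq])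
  rw [hc, h2]
  exact mul_dvd_mul_right (h5.dvd) _

/-- Two primitive representations in the same class relative to a base representation are
congruent up to a factor `2`. -/
theorem dvd_two_mul_cross_of_gcd_eq {D N X₀ Y₀ X₁ Y₁ X Y : ℤ} (hD : Squarefree D)
    (h₀ : X₀ ^ 2 + D * Y₀ ^ 2 = N) (h₁ : X₁ ^ 2 + D * Y₁ ^ 2 = N) (h : X ^ 2 + D * Y ^ 2 = N)
    (c₀ : IsCoprime X₀ Y₀) (c : IsCoprime X Y) (hN : N ≠ 0)
    (hgcd : Int.gcd (X * Y₀ - X₀ * Y) N = Int.gcd (X₁ * Y₀ - X₀ * Y₁) N) :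
    N ∣ 2 * (X * Y₁ - X₁ * Y) := by
  have copN : ∀ {x y : ℤ}, IsCoprime x y → x ^ 2 + D * y ^ 2 = N → IsCoprime y N := by
    intro x y hxy hxyN
    have h1 : IsCoprime y (x ^ 2) := hxy.symm.pow_right
    have h2 : N = x ^ 2 + y * (D * y) := by rw [← hxyN]; ring
    rw [h2]
    exact h1.add_mul_left_right _
  have quot : ∀ {x y : ℤ}, x ^ 2 + D * y ^ 2 = N → ∀ k,
      N = (Int.gcd (x * Y₀ - X₀ * y) N : ℤ) * k → k ∣ x * Y₀ + X₀ * y := by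
    intro x y hxy k hk
    have hpos : 0 < Int.gcd (x * Y₀ - X₀ * y) N := Int.gcd_pos_of_ne_zero_right _ hN
    obtain ⟨u', N', hcop, hu, hN'⟩ := Int.exists_gcd_one hpos
    set q : ℤ := (Int.gcd (x * Y₀ - X₀ * y) N : ℤ) with hq
    have hq0 : q ≠ 0 := by positivity
    have hkN : k = N' := mul_left_cancel₀ hq0 (by rw [← hk, hN', mul_comm])
    subst hkN
    have : q * k ∣ q * (u' * (x * Y₀ + X₀ * y)) := by
      refine ⟨Y₀ ^ 2 - y ^ 2, ?_⟩
      rw [← hk]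
      have : q * (u' * (x * Y₀ + X₀ * y)) = (x * Y₀ - X₀ * y) * (x * Y₀ + X₀ * y) := by
        rw [hu]; ring
      rw [this]
      linear_combination Y₀ ^ 2 * hxy - y ^ 2 * h₀
    have h2 := Int.dvd_of_mul_dvd_mul_left hq0 this
    exact (Int.isCoprime_iff_gcd_eq_one.mpr hcop).symm.dvd_of_dvd_mul_left h2
  set q : ℤ := (Int.gcd (X * Y₀ - X₀ * Y) N : ℤ) with hq
  have hq1 : q = (Int.gcd (X₁ * Y₀ - X₀ * Y₁) N : ℤ) := by rw [hq, hgcd]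
  have hqu : q ∣ X * Y₀ - X₀ * Y := Int.gcd_dvd_left ..
  have hqu1 : q ∣ X₁ * Y₀ - X₀ * Y₁ := by rw [hq1]; exact Int.gcd_dvd_left ..
  obtain ⟨k, hk⟩ : q ∣ N := Int.gcd_dvd_right ..
  have hkv := quot h k hk
  have hkv1 := quot h₁ k (by rw [← hq1]; exact hk)
  have cY₀ := copN c₀ h₀
  have cY := copN c h
  have hqw : q ∣ X * Y₁ - X₁ * Y := by
    have h1 : q ∣ Y₀ * (X * Y₁ - X₁ * Y) := by
      have : Y₀ * (X * Y₁ - X₁ * Y) = (X * Y₀ - X₀ * Y) * Y₁ - (X₁ * Y₀ - X₀ * Y₁) * Y := by ring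
      rw [this]
      exact dvd_sub (hqu.mul_right _) (hqu1.mul_right _)
    exact (cY₀.of_isCoprime_of_dvd_right ⟨k, hk⟩).symm.dvd_of_dvd_mul_left h1
  have hkw : k ∣ X * Y₁ - X₁ * Y := by
    have h1 : k ∣ Y₀ * (X * Y₁ - X₁ * Y) := by
      have : Y₀ * (X * Y₁ - X₁ * Y) = (X * Y₀ + X₀ * Y) * Y₁ - (X₁ * Y₀ + X₀ * Y₁) * Y := by ring
      rw [this]
      exact dvd_sub (hkv.mul_right _) (hkv1.mul_right _)
    exact (cY₀.of_isCoprime_of_dvd_right ⟨q, by rw [hk, mul_comm]⟩).symm.dvd_of_dvd_mul_left h1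
  set e : ℤ := (Int.gcd q k : ℤ) with he
  have heq : e ∣ q := Int.gcd_dvd_left ..
  have hek : e ∣ k := Int.gcd_dvd_right ..
  have heN : e ^ 2 ∣ N := by rw [hk, sq]; exact mul_dvd_mul heq hek
  have heN' : e ∣ N := heq.trans ⟨k, hk⟩
  have he2X : e ∣ 2 * X := by
    have : e ∣ Y₀ * (2 * X) := by
      have e1 : Y₀ * (2 * X) = (X * Y₀ - X₀ * Y) + (X * Y₀ + X₀ * Y) := by ring
      rw [e1]
      exact dvd_add (heq.trans hqu) (hek.trans hkv)
    exact (cY₀.of_isCoprime_of_dvd_right heN').symm.dvd_of_dvd_mul_left this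
  have he4D : e ^ 2 ∣ 4 * D := by
    have h1 : e ^ 2 ∣ Y ^ 2 * (4 * D) := by
      have e1 : Y ^ 2 * (4 * D) = 4 * N - (2 * X) ^ 2 := by rw [← h]; ring
      rw [e1]
      exact dvd_sub (heN.mul_left _) (pow_dvd_pow_of_dvd he2X 2)
    exact ((cY.of_isCoprime_of_dvd_right heN').pow).symm.dvd_of_dvd_mul_left h1
  have he2 := Int.dvd_two_of_sq_dvd_four_mul_squarefree hD he4D
  have hNe : N ∣ e * (X * Y₁ - X₁ * Y) := by
    rw [he, Int.gcd_eq_gcd_ab, add_mul]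
    refine dvd_add ?_ ?_
    · rw [hk, mul_assoc]
      exact mul_dvd_mul_left _ (hkw.mul_left _)
    · rw [hk, mul_comm q k, mul_assoc]
      exact mul_dvd_mul_left _ (hqw.mul_left _)
  exact hNe.trans (mul_dvd_mul_right he2 _)

theorem card_primitive_reps_le {D N : ℤ} (hD0 : 0 < D) (hD : Squarefree D) (hN : N ≠ 0)
    (S : Finset (ℤ × ℤ)) (hS : ∀ p ∈ S, p.1 ^ 2 + D * p.2 ^ 2 = N)
    (hcop : ∀ p ∈ S, IsCoprime p.1 p.2) :
    S.card ≤ 25 * N.natAbs.divisors.card := by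
  rcases S.eq_empty_or_nonempty with rfl | ⟨p₀, hp₀⟩
  · simp
  refine Finset.card_le_mul_card_image_of_maps_to
    (f := fun p : ℤ × ℤ => Int.gcd (p.1 * p₀.2 - p₀.1 * p.2) N) ?_ 25 ?_
  · intro p _
    simp only [Nat.mem_divisors]
    exact ⟨Int.gcd_dvd_natAbs_right .., by simpa using hN⟩
  intro b _
  set F := S.filter (fun p : ℤ × ℤ => Int.gcd (p.1 * p₀.2 - p₀.1 * p.2) N = b) with hF
  rcases F.eq_empty_or_nonempty with hFe | ⟨p₁, hp₁⟩
  · simp [hFe]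
  have hF1 := Finset.mem_filter.mp hp₁
  have hS1 := hS _ hF1.1
  have key : ∀ p ∈ F, ∃ a b : ℤ, 2 * (p.1 * p₁.1 + D * (p.2 * p₁.2)) = N * a ∧
      2 * (p.1 * p₁.2 - p₁.1 * p.2) = N * b ∧ a ^ 2 + D * b ^ 2 = 4 := by
    intro p hp
    have hFp := Finset.mem_filter.mp hp
    have hSp := hS _ hFp.1
    obtain ⟨b, hb⟩ := dvd_two_mul_cross_of_gcd_eq hD (hS _ hp₀) hS1 hSp (hcop _ hp₀)
      (hcop _ hFp.1) hN (by rw [hFp.2, hF1.2])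
    have hid : (2 * (p.1 * p₁.1 + D * (p.2 * p₁.2))) ^ 2 = N ^ 2 * (4 - D * b ^ 2) := by
      have : N ^ 2 * (4 - D * b ^ 2) = 4 * N * N - D * (N * b) ^ 2 := by ring
      rw [this, ← hb]
      nth_rw 1 [← hS1]
      rw [← hSp]
      ring
    obtain ⟨a, ha⟩ : N ∣ 2 * (p.1 * p₁.1 + D * (p.2 * p₁.2)) :=
      (Int.pow_dvd_pow_iff two_ne_zero).mp ⟨_, hid⟩
    refine ⟨a, b, ha, hb, ?_⟩
    rw [ha, mul_pow] at hid
    have := mul_left_cancel₀ (pow_ne_zero 2 hN) hid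
    linarith
  have hcard : ((Finset.Icc (-2 : ℤ) 2) ×ˢ (Finset.Icc (-2 : ℤ) 2)).card = 25 := by decide
  rw [← hcard]
  refine Finset.card_le_card_of_injOn (fun p : ℤ × ℤ =>
    (2 * (p.1 * p₁.1 + D * (p.2 * p₁.2)) / N, 2 * (p.1 * p₁.2 - p₁.1 * p.2) / N)) ?_ ?_
  · intro p hp
    obtain ⟨a, b, ha, hb, hab⟩ := key p hp
    have e1 : N * a / N = a := Int.mul_ediv_cancel_left a hN
    have e2 : N * b / N = b := Int.mul_ediv_cancel_left b hN
    have hb2 : b ^ 2 ≤ D * b ^ 2 := le_mul_of_one_le_left (sq_nonneg b) hD0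
    have hDb : 0 ≤ D * b ^ 2 := by positivity
    simp only [ha, hb, e1, e2, Finset.coe_product, Finset.coe_Icc, Set.mem_prod, Set.mem_Icc]
    refine ⟨⟨?_, ?_⟩, ?_, ?_⟩ <;> nlinarith [sq_nonneg a]
  · intro p hp p' hp' heq
    obtain ⟨a, b, ha, hb, hab⟩ := key p hp
    obtain ⟨a', b', ha', hb', hab'⟩ := key p' hp'
    have e : ∀ x, N * x / N = x := fun x => Int.mul_ediv_cancel_left x hN
    simp only [ha, hb, ha', hb', e, Prod.mk.injEq] at heq
    obtain ⟨rfl, rfl⟩ := heq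
    have hA := ha.trans ha'.symm
    have hB := hb.trans hb'.symm
    have h2N : 2 * N ≠ 0 := mul_ne_zero two_ne_zero hN
    refine Prod.ext (mul_left_cancel₀ h2N ?_) (mul_left_cancel₀ h2N ?_)
    · rw [← hS1]
      linear_combination p₁.1 * hA + D * p₁.2 * hB
    · rw [← hS1]
      linear_combination p₁.2 * hA - p₁.1 * hB

theorem card_reps_le {D N : ℤ} (hD0 : 0 < D) (hN : N ≠ 0)
    (S : Finset (ℤ × ℤ)) (hS : ∀ p ∈ S, p.1 ^ 2 + D * p.2 ^ 2 = N) :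
    S.card ≤ 25 * N.natAbs.divisors.card * N.natAbs.divisors.card := by
  wlog hD : Squarefree D generalizing D S
  · obtain ⟨d, f, hdf, hd⟩ := Nat.sq_mul_squarefree D.natAbs
    have hDdf : D = (f : ℤ) ^ 2 * d := by
      rw [← Int.natAbs_of_nonneg hD0.le, ← hdf]; push_cast; rfl
    have hd0 : (0 : ℤ) < d := by
      exact_mod_cast Nat.pos_of_ne_zero hd.ne_zero
    have hf0 : (f : ℤ) ≠ 0 := by
      rintro h
      rw [h] at hDdf
      simp at hDdf
      exact hD0.ne' hDdf
    have hinj : Function.Injective (fun p : ℤ × ℤ => (p.1, (f : ℤ) * p.2)) := by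
      rintro ⟨x, y⟩ ⟨x', y'⟩ h
      simp only [Prod.mk.injEq] at h
      exact Prod.ext h.1 (mul_left_cancel₀ hf0 h.2)
    rw [← Finset.card_image_of_injective S hinj]
    refine this hd0 _ ?_ (Int.squarefree_natCast.mpr hd)
    intro p hp
    obtain ⟨p', hp', rfl⟩ := Finset.mem_image.mp hp
    rw [← hS p' hp', hDdf]
    ring
  refine Finset.card_le_mul_card_image_of_maps_to
    (f := fun p : ℤ × ℤ => Int.gcd p.1 p.2) ?_ _ ?_
  · intro p hp
    simp only [Nat.mem_divisors]
    refine ⟨?_, by simpa using hN⟩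
    rw [← Int.natCast_dvd, ← hS p hp]
    exact dvd_add (dvd_pow (Int.gcd_dvd_left ..) two_ne_zero)
      ((dvd_pow (Int.gcd_dvd_right ..) two_ne_zero).mul_left _)
  intro g hg
  have hg0 : (g : ℤ) ≠ 0 := by
    exact_mod_cast (Nat.pos_of_mem_divisors hg).ne'
  set F := S.filter (fun p : ℤ × ℤ => Int.gcd p.1 p.2 = g) with hF
  have key : ∀ p ∈ F, ∃ x y : ℤ, p = (x * g, y * g) ∧ IsCoprime x y := by
    intro p hp
    obtain ⟨-, hpg⟩ := Finset.mem_filter.mp hp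
    obtain ⟨x, y, hxy, hx, hy⟩ := Int.exists_gcd_one (m := p.1) (n := p.2)
      (by rw [hpg]; exact Nat.pos_of_mem_divisors hg)
    rw [hpg] at hx hy
    exact ⟨x, y, Prod.ext hx hy, Int.isCoprime_iff_gcd_eq_one.mpr hxy⟩
  rcases F.eq_empty_or_nonempty with hFe | ⟨p₁, hp₁⟩
  · simp [hFe]
  obtain ⟨x₁, y₁, h₁, -⟩ := key p₁ hp₁
  have hM := hS p₁ (Finset.mem_filter.mp hp₁).1
  rw [h₁] at hM
  set M : ℤ := x₁ ^ 2 + D * y₁ ^ 2 with hMdef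
  have hNM : N = (g : ℤ) ^ 2 * M := by rw [← hM, hMdef]; ring
  have hM0 : M ≠ 0 := by
    intro h
    exact hN (by rw [hNM, h, mul_zero])
  have hdiv : M.natAbs.divisors.card ≤ N.natAbs.divisors.card := by
    refine Finset.card_le_card (Nat.divisors_subset_of_dvd (by simpa using hN) ?_)
    rw [hNM]
    exact Int.natAbs_dvd_natAbs.mpr (dvd_mul_left _ _)
  have hinj : Set.InjOn (fun p : ℤ × ℤ => (p.1 / (g : ℤ), p.2 / (g : ℤ))) F := by
    intro p hp p' hp' h
    obtain ⟨x, y, rfl, -⟩ := key p hp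
    obtain ⟨x', y', rfl, -⟩ := key p' hp'
    simp only [Int.mul_ediv_cancel _ hg0, Prod.mk.injEq] at h
    rw [h.1, h.2]
  rw [← Finset.card_image_of_injOn hinj]
  refine (card_primitive_reps_le hD0 hD hM0 _ ?_ ?_).trans (Nat.mul_le_mul_left 25 hdiv)
  · intro q hq
    obtain ⟨p, hp, rfl⟩ := Finset.mem_image.mp hq
    have hSp := hS p (Finset.mem_filter.mp hp).1
    obtain ⟨x, y, rfl, -⟩ := key p hp
    simp only [Int.mul_ediv_cancel _ hg0]
    refine mul_left_cancel₀ (pow_ne_zero 2 hg0) ?_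
    rw [← hNM, ← hSp]
    ring
  · intro q hq
    obtain ⟨p, hp, rfl⟩ := Finset.mem_image.mp hq
    obtain ⟨x, y, rfl, hxy⟩ := key p hp
    simpa only [Int.mul_ediv_cancel _ hg0] using hxy

/-- The number of integer representations `N = X² + D Y²` is `≪ M ^ ε` for `|N| ≤ M`,
uniformly in `D > 0`. -/
theorem exists_card_reps_le_rpow {ε : ℝ} (hε : 0 < ε) :
    ∃ C : ℝ, 1 ≤ C ∧ ∀ (D N : ℤ) (M : ℝ), 0 < D → 1 ≤ M → |(N : ℝ)| ≤ M →
      ∀ S : Finset (ℤ × ℤ), (∀ p ∈ S, p.1 ^ 2 + D * p.2 ^ 2 = N) → (S.card : ℝ) ≤ C * M ^ ε := by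
  obtain ⟨C, hC, h⟩ := exists_card_divisors_le_rpow (half_pos hε)
  refine ⟨25 * C * C, by nlinarith, fun D N M hD hM hNM S hS => ?_⟩
  have hMε : 1 ≤ M ^ ε := Real.one_le_rpow hM hε.le
  by_cases hN : N = 0
  · have hle : S.card ≤ 1 := by
      rw [Finset.card_le_one]
      have h0 : ∀ p ∈ S, p = 0 := by
        intro p hp
        have h1 := hS p hp
        rw [hN] at h1
        have h2 : 0 ≤ D * p.2 ^ 2 := by positivity
        have h3 : p.1 ^ 2 = 0 := by linarith [sq_nonneg p.1]
        have h4 : D * p.2 ^ 2 = 0 := by linarith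
        have h5 : p.2 ^ 2 = 0 := (mul_eq_zero.mp h4).resolve_left hD.ne'
        exact Prod.ext (pow_eq_zero_iff two_ne_zero |>.mp h3) (pow_eq_zero_iff two_ne_zero |>.mp h5)
      intro a ha b hb
      rw [h0 a ha, h0 b hb]
    have : (S.card : ℝ) ≤ 1 := by exact_mod_cast hle
    exact this.trans (one_le_mul_of_one_le_of_one_le (by nlinarith) hMε)
  · have h1 : (S.card : ℝ) ≤ 25 * N.natAbs.divisors.card * N.natAbs.divisors.card := by
      exact_mod_cast card_reps_le hD hN S hS
    have h2 : (N.natAbs.divisors.card : ℝ) ≤ C * M ^ (ε / 2) := by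
      refine (h N.natAbs (by simpa using hN)).trans ?_
      have : ((N.natAbs : ℕ) : ℝ) ≤ M := by
        rwa [Nat.cast_natAbs, Int.cast_abs]
      gcongr
    calc (S.card : ℝ) ≤ 25 * (C * M ^ (ε / 2)) * (C * M ^ (ε / 2)) := h1.trans (by gcongr)
      _ = 25 * C * C * (M ^ (ε / 2) * M ^ (ε / 2)) := by ring
      _ = 25 * C * C * M ^ ε := by rw [← Real.rpow_add (by linarith), add_halves]

theorem abs_mul_le_of_le {x y A B : ℝ} (hx : |x| ≤ A) (hy : |y| ≤ B) : |x * y| ≤ A * B := by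
  rw [abs_mul]
  exact mul_le_mul hx hy (abs_nonneg _) ((abs_nonneg _).trans hx)

theorem abs_add_le_of_le {x y A B : ℝ} (hx : |x| ≤ A) (hy : |y| ≤ B) : |x + y| ≤ A + B :=
  (abs_add_le x y).trans (add_le_add hx hy)

theorem abs_sub_le_of_le {x y A B : ℝ} (hx : |x| ≤ A) (hy : |y| ≤ B) : |x - y| ≤ A + B :=
  (abs_sub x y).trans (add_le_add hx hy)

theorem rpow_const_mul_pow {ε K M : ℝ} {k : ℕ} (hk : k ≠ 0) (hK : 0 ≤ K) (hM : 0 ≤ M) :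
    (K * M ^ k) ^ (ε / k) = K ^ (ε / k) * M ^ ε := by
  rw [Real.mul_rpow hK (by positivity), ← Real.rpow_natCast M k, ← Real.rpow_mul hM,
    mul_div_cancel₀ _ (by exact_mod_cast hk)]

/-- The number of integer points on a definite conic is `≪ M ^ ε`, where `M` bounds the
coefficients. -/
theorem exists_card_conic_le_rpow {ε : ℝ} (hε : 0 < ε) :
    ∃ C : ℝ, 1 ≤ C ∧ ∀ (a b c d e f : ℤ) (M : ℝ), 1 ≤ M → |(a : ℝ)| ≤ M → |(b : ℝ)| ≤ M →
      |(c : ℝ)| ≤ M → |(d : ℝ)| ≤ M → |(e : ℝ)| ≤ M → |(f : ℝ)| ≤ M → 0 < a → 0 < a * c - b ^ 2 →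
      ∀ S : Finset (ℤ × ℤ), (∀ p ∈ S, a * p.1 ^ 2 + 2 * b * p.1 * p.2 + c * p.2 ^ 2
        + 2 * d * p.1 + 2 * e * p.2 + f = 0) → (S.card : ℝ) ≤ C * M ^ ε := by
  obtain ⟨C, hC, h⟩ := exists_card_reps_le_rpow (ε := ε / (4 : ℕ)) (by positivity)
  refine ⟨C * 8 ^ (ε / (4 : ℕ)), ?_, ?_⟩
  · exact one_le_mul_of_one_le_of_one_le hC (Real.one_le_rpow (by norm_num) (by positivity))
  intro a b c d e f M hM ha hb hc hd he hf ha0 hΔ S hS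
  have hinj : Function.Injective (fun p : ℤ × ℤ =>
      ((a * c - b ^ 2) * p.2 + (a * e - b * d), a * p.1 + b * p.2 + d)) := by
    rintro ⟨x, y⟩ ⟨x', y'⟩ hp
    simp only [Prod.mk.injEq] at hp
    have hy : y = y' := mul_left_cancel₀ hΔ.ne' (by linarith [hp.1])
    subst hy
    exact Prod.ext (mul_left_cancel₀ ha0.ne' (by linarith [hp.2])) rfl
  rw [← Finset.card_image_of_injective S hinj, mul_assoc,
    ← rpow_const_mul_pow (by norm_num) (by norm_num) (by linarith)]
  refine h (a * c - b ^ 2) ((a * c - b ^ 2) * (d ^ 2 - a * f) + (a * e - b * d) ^ 2) _ hΔ ?_ ?_ _ ?_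
  · have := one_le_pow₀ hM (n := 4)
    linarith
  · push_cast
    simp only [sq]
    have h1 := abs_sub_le_of_le (abs_mul_le_of_le ha hc) (abs_mul_le_of_le hb hb)
    have h2 := abs_sub_le_of_le (abs_mul_le_of_le hd hd) (abs_mul_le_of_le ha hf)
    have h3 := abs_sub_le_of_le (abs_mul_le_of_le ha he) (abs_mul_le_of_le hb hd)
    refine (abs_add_le_of_le (abs_mul_le_of_le h1 h2) (abs_mul_le_of_le h3 h3)).trans (le_of_eq ?_)
    ring
  · intro p hp
    obtain ⟨p', hp', rfl⟩ := Finset.mem_image.mp hp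
    linear_combination (a * c - b ^ 2) * a * hS p' hp'

theorem abs_dotProduct_le {x y : Fin 4 → ℝ} {A B : ℝ} (hx : ∀ i, |x i| ≤ A) (hy : ∀ i, |y i| ≤ B) :
    |x ⬝ᵥ y| ≤ 4 * (A * B) := by
  rw [dotProduct]
  refine (Finset.abs_sum_le_sum_abs _ _).trans ?_
  refine (Finset.sum_le_card_nsmul _ _ (A * B) fun i _ => abs_mul_le_of_le (hx i) (hy i)).trans ?_
  simp

theorem abs_matMul_le {U V : Matrix (Fin 4) (Fin 4) ℝ} {A B : ℝ}
    (hU : ∀ i j, |U i j| ≤ A) (hV : ∀ i j, |V i j| ≤ B) (i j : Fin 4) :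
    |(U * V) i j| ≤ 4 * (A * B) := by
  rw [Matrix.mul_apply']
  exact abs_dotProduct_le (hU i) (fun k => hV k j)

theorem cast_dotProduct (x y : Fin 4 → ℤ) :
    ((x ⬝ᵥ y : ℤ) : ℝ) = (fun i => (x i : ℝ)) ⬝ᵥ (fun i => (y i : ℝ)) := by
  simp [dotProduct]

theorem abs_cast_dotProduct_le {x y : Fin 4 → ℤ} {A B : ℝ} (hx : ∀ i, |(x i : ℝ)| ≤ A)
    (hy : ∀ i, |(y i : ℝ)| ≤ B) : |((x ⬝ᵥ y : ℤ) : ℝ)| ≤ 4 * (A * B) := by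
  rw [cast_dotProduct]
  exact abs_dotProduct_le hx hy

theorem abs_cast_bilin_le {U : Matrix (Fin 4) (Fin 4) ℤ} {x y : Fin 4 → ℤ} {M A B : ℝ}
    (hU : ∀ i j, |(U i j : ℝ)| ≤ M) (hx : ∀ i, |(x i : ℝ)| ≤ A)
    (hy : ∀ i, |(y i : ℝ)| ≤ B) : |((x ⬝ᵥ U *ᵥ y : ℤ) : ℝ)| ≤ 16 * (A * M * B) := by
  refine (abs_cast_dotProduct_le hx (fun i => abs_cast_dotProduct_le (hU i) hy)).trans
    (le_of_eq ?_)
  ring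

/-- Positive definiteness of an integral matrix, tested on integral vectors. -/
def IntPosDef (U : Matrix (Fin 4) (Fin 4) ℤ) : Prop :=
  U.IsSymm ∧ ∀ v : Fin 4 → ℤ, v ≠ 0 → 0 < v ⬝ᵥ U *ᵥ v

theorem Matrix.IsSymm.dotProduct_mulVec_comm {U : Matrix (Fin 4) (Fin 4) ℤ} (hU : U.IsSymm)
    (v w : Fin 4 → ℤ) : v ⬝ᵥ U *ᵥ w = w ⬝ᵥ U *ᵥ v := by
  rw [dotProduct_comm, ← vecMul_transpose, hU.eq, ← dotProduct_mulVec]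

/-- The number of points of a two-parameter integral affine lattice on which a positive definite
form takes a given value. -/
theorem exists_card_plane_le_rpow {ε : ℝ} (hε : 0 < ε) :
    ∃ C : ℝ, 1 ≤ C ∧ ∀ (U : Matrix (Fin 4) (Fin 4) ℤ) (w₀ w₁ w₂ : Fin 4 → ℤ) (n : ℤ) (M : ℝ),
      1 ≤ M → (∀ i j, |(U i j : ℝ)| ≤ M) → (∀ i, |(w₀ i : ℝ)| ≤ M) → (∀ i, |(w₁ i : ℝ)| ≤ M) →
      (∀ i, |(w₂ i : ℝ)| ≤ M) → |(n : ℝ)| ≤ M → IntPosDef U →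
      (∀ s t : ℤ, s • w₁ + t • w₂ = 0 → s = 0 ∧ t = 0) →
      ∀ S : Finset (ℤ × ℤ), (∀ p ∈ S, (w₀ + p.1 • w₁ + p.2 • w₂) ⬝ᵥ
        U *ᵥ (w₀ + p.1 • w₁ + p.2 • w₂) = n) → (S.card : ℝ) ≤ C * M ^ ε := by
  obtain ⟨C, hC, h⟩ := exists_card_conic_le_rpow (ε := ε / (3 : ℕ)) (by positivity)
  refine ⟨C * 17 ^ (ε / (3 : ℕ)), ?_, ?_⟩
  · exact one_le_mul_of_one_le_of_one_le hC (Real.one_le_rpow (by norm_num) (by positivity))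
  intro U w₀ w₁ w₂ n M hM hU h₀ h₁ h₂ hn hpos hind S hS
  rw [mul_assoc, ← rpow_const_mul_pow (by norm_num) (by norm_num) (by linarith)]
  have bd : ∀ {x y : Fin 4 → ℤ}, (∀ i, |(x i : ℝ)| ≤ M) → (∀ i, |(y i : ℝ)| ≤ M) →
      |((x ⬝ᵥ U *ᵥ y : ℤ) : ℝ)| ≤ 16 * M ^ 3 := fun hx hy =>
    (abs_cast_bilin_le hU hx hy).trans (le_of_eq (by ring))
  have hM3 : M ≤ M ^ 3 := le_self_pow₀ hM (by norm_num)
  have bd' : ∀ {x y : Fin 4 → ℤ}, (∀ i, |(x i : ℝ)| ≤ M) → (∀ i, |(y i : ℝ)| ≤ M) →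
      |((x ⬝ᵥ U *ᵥ y : ℤ) : ℝ)| ≤ 17 * M ^ 3 := fun hx hy => (bd hx hy).trans (by linarith)
  have hw₁ : w₁ ≠ 0 := by
    rintro rfl
    simpa using (hind 1 0 (by simp)).1
  have hsymm := hpos.1.dotProduct_mulVec_comm
  have ha := hpos.2 w₁ hw₁
  refine h (w₁ ⬝ᵥ U *ᵥ w₁) (w₁ ⬝ᵥ U *ᵥ w₂) (w₂ ⬝ᵥ U *ᵥ w₂) (w₀ ⬝ᵥ U *ᵥ w₁) (w₀ ⬝ᵥ U *ᵥ w₂)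
    (w₀ ⬝ᵥ U *ᵥ w₀ - n) _ (by linarith) (bd' h₁ h₁) (bd' h₁ h₂) (bd' h₂ h₂) (bd' h₀ h₁) (bd' h₀ h₂)
    ?_ ha ?_ S ?_
  · push_cast
    exact (abs_sub_le_of_le (bd h₀ h₀) hn).trans (by linarith)
  · set a := w₁ ⬝ᵥ U *ᵥ w₁ with hadef
    set b := w₁ ⬝ᵥ U *ᵥ w₂ with hbdef
    have hne : (-b) • w₁ + a • w₂ ≠ 0 := fun hz => ha.ne' (hind _ _ hz).2
    have hp := hpos.2 _ hne
    have hexp : ((-b) • w₁ + a • w₂) ⬝ᵥ U *ᵥ ((-b) • w₁ + a • w₂)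
        = a * (a * (w₂ ⬝ᵥ U *ᵥ w₂) - b ^ 2) := by
      simp only [mulVec_add, mulVec_smul, add_dotProduct, dotProduct_add, smul_dotProduct,
        dotProduct_smul, smul_eq_mul, hsymm w₂ w₁, ← hadef, ← hbdef]
      ring
    rw [hexp] at hp
    exact pos_of_mul_pos_right hp ha.le
  · intro p hp
    rw [← hS p hp]
    simp only [mulVec_add, mulVec_smul, add_dotProduct, dotProduct_add, smul_dotProduct,
        dotProduct_smul, smul_eq_mul, hsymm w₂ w₁, hsymm w₁ w₀, hsymm w₂ w₀]
    ring

theorem IntPosDef.submatrix {U : Matrix (Fin 4) (Fin 4) ℤ} (hU : IntPosDef U)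
    (σ : Equiv.Perm (Fin 4)) : IntPosDef (U.submatrix σ σ) := by
  refine ⟨hU.1.submatrix σ, fun v hv => ?_⟩
  have h1 := hU.2 (v ∘ σ.symm) (fun h => hv ?_)
  · rwa [submatrix_mulVec_equiv, ← comp_equiv_symm_dotProduct]
  · ext i
    simpa using congrFun h (σ i)

theorem exists_perm_four (i j : Fin 4) (hij : i ≠ j) :
    ∃ σ : Equiv.Perm (Fin 4), σ 0 = i ∧ σ 1 = j := by
  refine ⟨(Equiv.swap 0 i).trans (Equiv.swap (Equiv.swap 0 i 1) j), ?_, ?_⟩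
  · simp
    revert i j
    decide
  · simp

/-- The number of integral solutions of two independent linear equations and one positive definite
quadratic equation in four variables. -/
theorem exists_card_two_linear_le_rpow {ε : ℝ} (hε : 0 < ε) :
    ∃ C : ℝ, 1 ≤ C ∧ ∀ (U : Matrix (Fin 4) (Fin 4) ℤ) (p q : Fin 4 → ℤ) (c₁ c₂ c₃ : ℤ) (M : ℝ),
      1 ≤ M → (∀ i j, |(U i j : ℝ)| ≤ M) → (∀ i, |(p i : ℝ)| ≤ M) → (∀ i, |(q i : ℝ)| ≤ M) →
      |(c₁ : ℝ)| ≤ M → |(c₂ : ℝ)| ≤ M → |(c₃ : ℝ)| ≤ M → IntPosDef U →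
      (∃ i j, p i * q j - p j * q i ≠ 0) →
      ∀ S : Finset (Fin 4 → ℤ), (∀ y ∈ S, p ⬝ᵥ y = c₁ ∧ q ⬝ᵥ y = c₂ ∧ y ⬝ᵥ U *ᵥ y = c₃) →
        (S.card : ℝ) ≤ C * M ^ ε := by
  obtain ⟨C, hC, h⟩ := exists_card_plane_le_rpow (ε := ε / (5 : ℕ)) (by positivity)
  refine ⟨C * 4 ^ (ε / (5 : ℕ)), ?_, ?_⟩
  · exact one_le_mul_of_one_le_of_one_le hC (Real.one_le_rpow (by norm_num) (by positivity))
  intro U p q c₁ c₂ c₃ M hM hU hp hq hc₁ hc₂ hc₃ hpos hij S hS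
  wlog h01 : p 0 * q 1 - p 1 * q 0 ≠ 0 generalizing U p q S
  · obtain ⟨i, j, hij⟩ := hij
    have hne : i ≠ j := by
      rintro rfl
      simp at hij
    obtain ⟨σ, h0, h1⟩ := exists_perm_four i j hne
    have hinj : Function.Injective (fun y : Fin 4 → ℤ => y ∘ σ) := σ.surjective.injective_comp_right
    rw [← Finset.card_image_of_injective S hinj]
    have h01 : (p ∘ σ) 0 * (q ∘ σ) 1 - (p ∘ σ) 1 * (q ∘ σ) 0 ≠ 0 := by simpa [h0, h1] using hij
    refine this (U.submatrix σ σ) (p ∘ σ) (q ∘ σ) (fun i j => hU _ _) (fun i => hp _)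
      (fun i => hq _) (hpos.submatrix σ) ⟨0, 1, h01⟩ _ ?_ h01
    intro y hy
    obtain ⟨y', hy', rfl⟩ := Finset.mem_image.mp hy
    obtain ⟨e1, e2, e3⟩ := hS y' hy'
    refine ⟨?_, ?_, ?_⟩
    · rw [comp_equiv_dotProduct_comp_equiv, e1]
    · rw [comp_equiv_dotProduct_comp_equiv, e2]
    · rw [submatrix_mulVec_equiv, comp_equiv_dotProduct_comp_equiv, Function.comp_assoc,
        σ.self_comp_symm, Function.comp_id, e3]
  set μ := p 0 * q 1 - p 1 * q 0 with hμ
  have hy : ∀ y ∈ S, ![q 1 * c₁ - p 1 * c₂, p 0 * c₂ - q 0 * c₁, 0, 0]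
      + y 2 • ![p 1 * q 2 - q 1 * p 2, q 0 * p 2 - p 0 * q 2, μ, 0]
      + y 3 • ![p 1 * q 3 - q 1 * p 3, q 0 * p 3 - p 0 * q 3, 0, μ] = μ • y := by
    intro y hy
    obtain ⟨e1, e2, -⟩ := hS y hy
    simp only [dotProduct, Fin.sum_univ_four] at e1 e2
    ext i
    fin_cases i
    · simp [hμ]
      linear_combination - q 1 * e1 + p 1 * e2
    · simp [hμ]
      linear_combination q 0 * e1 - p 0 * e2
    · simp; ring
    · simp; ring
  have hinj : Set.InjOn (fun y : Fin 4 → ℤ => (y 2, y 3)) S := by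
    intro y hyS y' hyS' heq
    simp only [Prod.mk.injEq] at heq
    have e1 := hy y hyS
    rw [heq.1, heq.2, hy y' hyS'] at e1
    ext i
    have := congrFun e1 i
    simp only [Pi.smul_apply, smul_eq_mul] at this
    exact (mul_left_cancel₀ h01 this).symm
  rw [← Finset.card_image_of_injOn hinj, mul_assoc,
    ← rpow_const_mul_pow (by norm_num) (by norm_num) (by linarith)]
  have hM1 : M ≤ M ^ 5 := le_self_pow₀ hM (by norm_num)
  have hM2 : M ^ 2 ≤ M ^ 5 := pow_le_pow_right₀ hM (by norm_num)
  have bd : ∀ {x y z w : ℤ}, |(x : ℝ)| ≤ M → |(y : ℝ)| ≤ M → |(z : ℝ)| ≤ M → |(w : ℝ)| ≤ M →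
      |((x * y - z * w : ℤ) : ℝ)| ≤ 4 * M ^ 5 := by
    intro x y z w hx hy hz hw
    push_cast
    exact (abs_sub_le_of_le (abs_mul_le_of_le hx hy) (abs_mul_le_of_le hz hw)).trans (by nlinarith)
  have bd0 : |((0 : ℤ) : ℝ)| ≤ 4 * M ^ 5 := by
    simp
    positivity
  refine h U ![q 1 * c₁ - p 1 * c₂, p 0 * c₂ - q 0 * c₁, 0, 0]
    ![p 1 * q 2 - q 1 * p 2, q 0 * p 2 - p 0 * q 2, μ, 0]
    ![p 1 * q 3 - q 1 * p 3, q 0 * p 3 - p 0 * q 3, 0, μ] (μ ^ 2 * c₃) _ (by linarith)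
    (fun i j => (hU i j).trans (by linarith)) ?_ ?_ ?_ ?_ hpos ?_ _ ?_
  · intro i
    fin_cases i
    exacts [bd (hq _) hc₁ (hp _) hc₂, bd (hp _) hc₂ (hq _) hc₁, bd0, bd0]
  · intro i
    fin_cases i
    exacts [bd (hp _) (hq _) (hq _) (hp _), bd (hq _) (hp _) (hp _) (hq _),
      bd (hp _) (hq _) (hp _) (hq _), bd0]
  · intro i
    fin_cases i
    exacts [bd (hp _) (hq _) (hq _) (hp _), bd (hq _) (hp _) (hp _) (hq _),
      bd0, bd (hp _) (hq _) (hp _) (hq _)]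
  · have hμb : |(μ : ℝ)| ≤ 2 * M ^ 2 := by
      rw [hμ]
      push_cast
      exact (abs_sub_le_of_le (abs_mul_le_of_le (hp _) (hq _))
        (abs_mul_le_of_le (hp _) (hq _))).trans (le_of_eq (by ring))
    push_cast
    rw [sq]
    exact (abs_mul_le_of_le (abs_mul_le_of_le hμb hμb) hc₃).trans (le_of_eq (by ring))
  · intro s t hst
    have h2 := congrFun hst 2
    have h3 := congrFun hst 3
    simp at h2 h3
    exact ⟨h2.resolve_right h01, h3.resolve_right h01⟩
  · intro r hr
    obtain ⟨y, hyS, rfl⟩ := Finset.mem_image.mp hr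
    simp only [hy y hyS]
    rw [mulVec_smul, smul_dotProduct, dotProduct_smul, (hS y hyS).2.2]
    simp only [smul_eq_mul]
    ring

theorem card_le_mul_card_of_fiber_le {α β : Type*} [DecidableEq β] {f : α → β} {S : Finset α}
    {T : Finset β} (hf : ∀ a ∈ S, f a ∈ T) {b : ℝ}
    (hb : ∀ t ∈ T, ((S.filter (fun a => f a = t)).card : ℝ) ≤ b) : (S.card : ℝ) ≤ b * T.card := by
  rw [Finset.card_eq_sum_card_fiberwise hf, Nat.cast_sum, mul_comm, ← nsmul_eq_mul]
  exact Finset.sum_le_card_nsmul _ _ _ hb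

theorem transpose_mul_mul_apply {R : Type*} [CommRing R] (γ U : Matrix (Fin 4) (Fin 4) R)
    (i j : Fin 4) : (γᵀ * U * γ) i j = γᵀ i ⬝ᵥ U *ᵥ γᵀ j := by
  rw [Matrix.mul_assoc, mul_apply']
  congr 1

/-- The integral standard symplectic matrix. -/
def JmatInt : Matrix (Fin 4) (Fin 4) ℤ := !![0, 0, 1, 0; 0, 0, 0, 1; -1, 0, 0, 0; 0, -1, 0, 0]

theorem JmatInt_map : JmatInt.map (Int.cast : ℤ → ℝ) = Jmat := by
  ext i j
  fin_cases i <;> fin_cases j <;> simp [JmatInt, Jmat]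

theorem dotProduct_JmatInt_mulVec_self (x : Fin 4 → ℤ) : x ⬝ᵥ JmatInt *ᵥ x = 0 := by
  simp [JmatInt, dotProduct, mulVec, Fin.sum_univ_four]
  ring

theorem JmatInt_mulVec_injective {x : Fin 4 → ℤ} (h : JmatInt *ᵥ x = 0) : x = 0 := by
  have h0 := congrFun h 0
  have h1 := congrFun h 1
  have h2 := congrFun h 2
  have h3 := congrFun h 3
  simp [JmatInt, mulVec, dotProduct, Fin.sum_univ_four] at h0 h1 h2 h3
  ext i
  fin_cases i <;> simp [h0, h1, h2, h3]

theorem exists_minor_ne_zero {U : Matrix (Fin 4) (Fin 4) ℤ} (hU : IntPosDef U) {x : Fin 4 → ℤ}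
    (hx : x ≠ 0) : ∃ i j, (U *ᵥ x) i * (JmatInt *ᵥ x) j - (U *ᵥ x) j * (JmatInt *ᵥ x) i ≠ 0 := by
  by_contra! h
  refine hx (JmatInt_mulVec_injective ?_)
  ext j
  have h1 : (x ⬝ᵥ U *ᵥ x) * (JmatInt *ᵥ x) j - (U *ᵥ x) j * (x ⬝ᵥ JmatInt *ᵥ x) = 0 := by
    have : ∑ i, x i * ((U *ᵥ x) i * (JmatInt *ᵥ x) j - (U *ᵥ x) j * (JmatInt *ᵥ x) i) = 0 := by
      simp [h]
    rw [← this]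
    simp only [dotProduct, Finset.sum_mul, Finset.mul_sum, ← Finset.sum_sub_distrib]
    exact Finset.sum_congr rfl fun i _ => by ring
  rw [dotProduct_JmatInt_mulVec_self, mul_zero, sub_zero] at h1
  exact (mul_eq_zero.mp h1).resolve_left (hU.2 x hx).ne'

theorem IntPosDef.diag_pos {U : Matrix (Fin 4) (Fin 4) ℤ} (hU : IntPosDef U) (i : Fin 4) :
    0 < U i i := by
  have := hU.2 (Pi.single i 1) (by simp)
  simpa using this

/-- The number of short vectors on which a positive definite form takes a given value. -/
theorem exists_card_vectors_le_rpow {ε : ℝ} (hε : 0 < ε) :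
    ∃ C : ℝ, 1 ≤ C ∧ ∀ (U : Matrix (Fin 4) (Fin 4) ℤ) (n : ℤ) (M : ℝ) (R : ℕ),
      1 ≤ M → (∀ i j, |(U i j : ℝ)| ≤ M) → |(n : ℝ)| ≤ M → (R : ℝ) ≤ M → IntPosDef U →
      ∀ S : Finset (Fin 4 → ℤ), (∀ x ∈ S, x ⬝ᵥ U *ᵥ x = n ∧ ∀ i, |x i| ≤ R) →
        (S.card : ℝ) ≤ C * M ^ ε * (2 * R + 1) ^ 2 := by
  obtain ⟨C, hC, h⟩ := exists_card_plane_le_rpow hε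
  refine ⟨C, hC, fun U n M R hM hU hn hR hpos S hS => ?_⟩
  have hcard : (((Finset.Icc (-R : ℤ) R) ×ˢ (Finset.Icc (-R : ℤ) R)).card : ℝ)
      = (2 * R + 1) ^ 2 := by
    rw [Finset.card_product, Int.card_Icc, sq]
    have : ((R : ℤ) + 1 - -R).toNat = 2 * R + 1 := by omega
    rw [this]
    push_cast
    ring
  rw [← hcard]
  refine card_le_mul_card_of_fiber_le (f := fun x : Fin 4 → ℤ => (x 2, x 3)) ?_ ?_
  · intro x hx
    simp only [Finset.mem_product, Finset.mem_Icc]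
    exact ⟨abs_le.mp ((hS x hx).2 2), abs_le.mp ((hS x hx).2 3)⟩
  rintro ⟨s, t⟩ hst
  simp only [Finset.mem_product, Finset.mem_Icc, ← abs_le] at hst
  have hbd : ∀ {a : ℤ}, |a| ≤ R → |(a : ℝ)| ≤ M := fun ha => by
    refine le_trans ?_ hR
    exact_mod_cast ha
  have hx : ∀ x ∈ S.filter (fun x : Fin 4 → ℤ => (x 2, x 3) = (s, t)),
      ![0, 0, s, t] + x 0 • ![1, 0, 0, 0] + x 1 • ![0, 1, 0, 0] = x := by
    intro x hx
    have h2 := (Finset.mem_filter.mp hx).2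
    simp only [Prod.mk.injEq] at h2
    ext i
    fin_cases i <;> simp [h2]
  have hinj : Set.InjOn (fun x : Fin 4 → ℤ => (x 0, x 1))
      (S.filter (fun x : Fin 4 → ℤ => (x 2, x 3) = (s, t))) := by
    intro x hxS y hyS heq
    simp only [Prod.mk.injEq] at heq
    rw [← hx x hxS, ← hx y hyS, heq.1, heq.2]
  rw [← Finset.card_image_of_injOn hinj]
  have b0 : |((0 : ℤ) : ℝ)| ≤ M := by simpa using by linarith
  have b1 : |((1 : ℤ) : ℝ)| ≤ M := by simpa using hM
  refine h U ![0, 0, s, t] ![1, 0, 0, 0] ![0, 1, 0, 0] n M hM hU ?_ ?_ ?_ hn hpos ?_ _ ?_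
  · intro i
    fin_cases i
    exacts [b0, b0, hbd hst.1, hbd hst.2]
  · intro i
    fin_cases i
    exacts [b1, b0, b0, b0]
  · intro i
    fin_cases i
    exacts [b0, b1, b0, b0]
  · intro a b hab
    have h0 := congrFun hab 0
    have h1 := congrFun hab 1
    simp at h0 h1
    exact ⟨h0, h1⟩
  · intro r hr
    obtain ⟨y, hyS, rfl⟩ := Finset.mem_image.mp hr
    simp only [hx y hyS]
    exact (hS y (Finset.mem_filter.mp hyS).1).1

/-- The number of integral symplectic similitudes of multiplier `m` which are also similitudes of a
positive definite integral form is `≪ R² M ^ ε`, where `R` bounds the entries of the similitudes and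
`M` bounds all the data. -/
theorem exists_card_similitudes_le {ε : ℝ} (hε : 0 < ε) :
    ∃ C : ℝ, 1 ≤ C ∧ ∀ (U : Matrix (Fin 4) (Fin 4) ℤ) (m : ℤ) (M : ℝ) (R : ℕ),
      1 ≤ M → (∀ i j, |(U i j : ℝ)| ≤ M) → |(m : ℝ)| ≤ M → (R : ℝ) ≤ M → 0 < m → IntPosDef U →
      ∀ S : Finset (Matrix (Fin 4) (Fin 4) ℤ), (∀ γ ∈ S, γᵀ * U * γ = m • U ∧
        γᵀ * JmatInt * γ = m • JmatInt ∧ ∀ i j, |γ i j| ≤ R) →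
        (S.card : ℝ) ≤ C * M ^ ε * (2 * R + 1) ^ 2 := by
  have hε8 : 0 < ε / 8 := by positivity
  obtain ⟨C₁, hC₁, h₁⟩ := exists_card_vectors_le_rpow hε8
  obtain ⟨C₂, hC₂, h₂⟩ := exists_card_two_linear_le_rpow hε8
  refine ⟨C₂ ^ 3 * C₁ * 4 ^ (ε / 2), ?_, ?_⟩
  · exact one_le_mul_of_one_le_of_one_le (one_le_mul_of_one_le_of_one_le (one_le_pow₀ hC₂) hC₁)
      (Real.one_le_rpow (by norm_num) (by positivity))
  intro U m M R hM hU hm hR hm0 hpos S hS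
  set Z : ℝ := (4 * M ^ 2) ^ (ε / 8) with hZ
  have hZ4 : Z ^ 4 = 4 ^ (ε / 2) * M ^ ε := by
    have h4 := rpow_const_mul_pow (ε := ε) (K := 4) (M := M) (k := 2) (by norm_num) (by norm_num)
      (by linarith)
    push_cast at h4
    rw [hZ, ← Real.rpow_natCast, ← Real.rpow_mul (by positivity), ← h4]
    congr 1
    push_cast
    ring
  have hMM : M ≤ 4 * M ^ 2 := by nlinarith
  have hM1 : 1 ≤ 4 * M ^ 2 := hM.trans hMM
  have hbd : ∀ {a : ℤ}, |a| ≤ R → |(a : ℝ)| ≤ M := fun ha => by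
    refine le_trans ?_ hR
    exact_mod_cast ha
  have hmU : ∀ i j, |((m * U i j : ℤ) : ℝ)| ≤ 4 * M ^ 2 := fun i j => by
    push_cast
    exact (abs_mul_le_of_le hm (hU i j)).trans (by nlinarith)
  have hJ : ∀ i j, |(JmatInt i j : ℝ)| ≤ 1 := by
    intro i j
    fin_cases i <;> fin_cases j <;> simp [JmatInt]
  have hmJ : ∀ i j, |((m * JmatInt i j : ℤ) : ℝ)| ≤ 4 * M ^ 2 := fun i j => by
    push_cast
    exact (abs_mul_le_of_le hm (hJ i j)).trans (by linarith)
  have hformU : ∀ γ ∈ S, ∀ i j, γᵀ i ⬝ᵥ U *ᵥ γᵀ j = m * U i j := fun γ hγ i j => by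
    rw [← transpose_mul_mul_apply, (hS γ hγ).1]
    simp
  have hformJ : ∀ γ ∈ S, ∀ i j, γᵀ i ⬝ᵥ JmatInt *ᵥ γᵀ j = m * JmatInt i j := fun γ hγ i j => by
    rw [← transpose_mul_mul_apply, (hS γ hγ).2.1]
    simp
  have hfirst := h₁ U (m * U 0 0) _ R hM1 (fun i j => (hU i j).trans hMM) (hmU 0 0) (hR.trans hMM)
    hpos (S.image fun γ => γᵀ 0) (by
      intro x hx
      obtain ⟨γ, hγ, rfl⟩ := Finset.mem_image.mp hx
      exact ⟨hformU γ hγ 0 0, fun i => (hS γ hγ).2.2 i 0⟩)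
  have hfib : ∀ x ∈ S.image (fun γ => γᵀ 0),
      ((S.filter (fun γ => γᵀ 0 = x)).card : ℝ) ≤ (C₂ * Z) ^ 3 := by
    intro x hx
    obtain ⟨γ₀, hγ₀, hγx⟩ := Finset.mem_image.mp hx
    have hx0 : x ≠ 0 := by
      rintro rfl
      have := hformU γ₀ hγ₀ 0 0
      rw [hγx, zero_dotProduct] at this
      exact (mul_pos hm0 (hpos.diag_pos 0)).ne this
    have hxb : ∀ i, |(x i : ℝ)| ≤ M := fun i => by
      rw [← hγx]
      exact hbd ((hS γ₀ hγ₀).2.2 i 0)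
    set F := S.filter (fun γ => γᵀ 0 = x) with hF
    have hcol : ∀ j, ((F.image fun γ => γᵀ j).card : ℝ) ≤ C₂ * Z := by
      intro j
      refine h₂ U (U *ᵥ x) (JmatInt *ᵥ x) (m * U j 0) (m * JmatInt j 0) (m * U j j) _ hM1
        (fun i j => (hU i j).trans hMM) ?_ ?_ (hmU _ _) (hmJ _ _) (hmU _ _) hpos
        (exists_minor_ne_zero hpos hx0) _ ?_
      · intro i
        exact (abs_cast_dotProduct_le (hU i) hxb).trans (le_of_eq (by ring))
      · intro i
        exact (abs_cast_dotProduct_le (hJ i) hxb).trans (by nlinarith)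
      · intro y hy
        obtain ⟨γ, hγ, rfl⟩ := Finset.mem_image.mp hy
        obtain ⟨hγS, rfl⟩ := Finset.mem_filter.mp hγ
        refine ⟨?_, ?_, hformU γ hγS j j⟩
        · rw [dotProduct_comm, hformU γ hγS]
        · rw [dotProduct_comm, hformJ γ hγS]
    have hinj : F.card ≤ ((F.image fun γ => γᵀ 1) ×ˢ (F.image fun γ => γᵀ 2) ×ˢ
        (F.image fun γ => γᵀ 3)).card := by
      refine Finset.card_le_card_of_injOn (fun γ => (γᵀ 1, γᵀ 2, γᵀ 3)) ?_ ?_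
      · intro γ hγ
        simp only [Finset.coe_product, Set.mem_prod]
        exact ⟨Finset.mem_image_of_mem _ hγ, Finset.mem_image_of_mem _ hγ,
          Finset.mem_image_of_mem _ hγ⟩
      · intro γ hγ γ' hγ' heq
        simp only [Prod.mk.injEq] at heq
        have h0 : γᵀ 0 = γ'ᵀ 0 := by
          rw [(Finset.mem_filter.mp hγ).2, (Finset.mem_filter.mp hγ').2]
        refine transpose_injective (funext fun j => ?_)
        fin_cases j
        exacts [h0, heq.1, heq.2.1, heq.2.2]
    rw [Finset.card_product, Finset.card_product] at hinj
    have hinj' : (F.card : ℝ) ≤ (F.image fun γ => γᵀ 1).card *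
        ((F.image fun γ => γᵀ 2).card * (F.image fun γ => γᵀ 3).card) := by exact_mod_cast hinj
    refine hinj'.trans ?_
    have := hcol 1
    have := hcol 2
    have := hcol 3
    calc _ ≤ (C₂ * Z) * ((C₂ * Z) * (C₂ * Z)) := by gcongr
      _ = _ := by ring
  have htot := card_le_mul_card_of_fiber_le (fun γ hγ => Finset.mem_image_of_mem _ hγ) hfib
  calc (S.card : ℝ) ≤ (C₂ * Z) ^ 3 * (C₁ * Z * (2 * R + 1) ^ 2) := htot.trans (by gcongr)
    _ = C₂ ^ 3 * C₁ * Z ^ 4 * (2 * R + 1) ^ 2 := by ring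
    _ = _ := by rw [hZ4]; ring

/-- **Dirichlet's theorem** on simultaneous Diophantine approximation. -/
theorem exists_nat_int_abs_mul_sub_le {ι : Type*} [Fintype ι] (v : ι → ℝ) {n : ℕ} (hn : 0 < n) :
    ∃ q : ℕ, 0 < q ∧ q ≤ n ^ Fintype.card ι ∧ ∃ u : ι → ℤ, ∀ i, |q * v i - u i| ≤ 1 / n := by
  classical
  have hn' : (0 : ℝ) < n := by exact_mod_cast hn
  obtain ⟨a, ha, b, hb, hab, hfab⟩ := Finset.exists_ne_map_eq_of_card_lt_of_maps_to
    (s := Finset.range (n ^ Fintype.card ι + 1))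
    (t := Fintype.piFinset fun _ : ι => Finset.Ico (0 : ℤ) n)
    (f := fun (k : ℕ) (i : ι) => ⌊(n : ℝ) * Int.fract (k * v i)⌋) (by simp) (by
      intro k _
      simp only [Fintype.coe_piFinset, Finset.coe_Ico, Set.mem_pi, Set.mem_Ico, Set.mem_univ,
        forall_const]
      intro i
      refine ⟨Int.floor_nonneg.mpr (mul_nonneg hn'.le (Int.fract_nonneg _)), ?_⟩
      rw [Int.floor_lt]
      push_cast
      exact mul_lt_of_lt_one_right hn' (Int.fract_lt_one _))
  wlog hlt : a < b generalizing a b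
  · exact this b hb a ha hab.symm hfab.symm (lt_of_le_of_ne (not_lt.mp hlt) hab.symm)
  have hb' := Finset.mem_range.mp hb
  refine ⟨b - a, by omega, by omega, fun i => ⌊(b : ℝ) * v i⌋ - ⌊(a : ℝ) * v i⌋, fun i => ?_⟩
  have h1 := Int.abs_sub_lt_one_of_floor_eq_floor (congrFun hfab i)
  rw [← mul_sub, abs_mul, abs_of_pos hn'] at h1
  rw [le_div_iff₀ hn', mul_comm]
  refine le_of_eq_of_le ?_ h1.le
  rw [Nat.cast_sub hlt.le, abs_sub_comm (Int.fract _)]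
  congr 2
  simp only [Int.fract]
  push_cast
  ring

theorem exists_abs_entry_le (X : Matrix (Fin 4) (Fin 4) ℝ) :
    ∃ A : ℝ, 1 ≤ A ∧ ∀ i j, |X i j| ≤ A := by
  refine ⟨1 + ∑ i, ∑ j, |X i j|, ?_, fun i j => ?_⟩
  · have : 0 ≤ ∑ i, ∑ j, |X i j| := by positivity
    linarith
  · have h1 : |X i j| ≤ ∑ j, |X i j| :=
      Finset.single_le_sum (f := fun j => |X i j|) (fun _ _ => abs_nonneg _) (Finset.mem_univ j)
    have h2 : ∑ j, |X i j| ≤ ∑ i, ∑ j, |X i j| :=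
      Finset.single_le_sum (f := fun i => ∑ j, |X i j|) (fun _ _ => by positivity)
        (Finset.mem_univ i)
    linarith

theorem Jmat_mul_Jmat : Jmat * Jmat = -1 := by
  ext i j
  fin_cases i <;> fin_cases j <;> simp [Jmat, mul_apply, Fin.sum_univ_four]

theorem isUnit_det_of_mem_Sp4 {g : Matrix (Fin 4) (Fin 4) ℝ} (hg : g ∈ Sp4) : IsUnit g.det := by
  have h : (-(Jmat * gᵀ * Jmat)) * g = 1 := by
    have hg' : gᵀ * Jmat * g = Jmat := hg
    rw [Matrix.neg_mul, Matrix.mul_assoc, Matrix.mul_assoc, ← Matrix.mul_assoc gᵀ, hg',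
      Jmat_mul_Jmat, neg_neg]
  exact isUnit_det_of_left_inverse h

theorem abs_entry_le_one_of_mem_Ksp {k : Matrix (Fin 4) (Fin 4) ℝ} (hk : k ∈ Ksp) (i j : Fin 4) :
    |k i j| ≤ 1 := by
  have h : (kᵀ * k) j j = 1 := by rw [hk.2]; simp
  rw [mul_apply] at h
  have h1 : k i j * k i j ≤ ∑ l, k l j * k l j :=
    Finset.single_le_sum (f := fun l => k l j * k l j) (fun _ _ => mul_self_nonneg _)
      (Finset.mem_univ i)
  simp only [transpose_apply] at h
  rw [h, ← sq] at h1
  exact (sq_le_one_iff_abs_le_one _).mp h1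

theorem exists_abs_conj_entry_le (g : Matrix (Fin 4) (Fin 4) ℝ) :
    ∃ A : ℝ, 1 ≤ A ∧ ∀ k ∈ Ksp, ∀ i j, |(g * k * g⁻¹) i j| ≤ A := by
  obtain ⟨a, ha, hga⟩ := exists_abs_entry_le g
  obtain ⟨b, hb, hgb⟩ := exists_abs_entry_le g⁻¹
  refine ⟨4 * (4 * (a * 1) * b), by nlinarith, fun k hk => ?_⟩
  exact abs_matMul_le (abs_matMul_le hga (abs_entry_le_one_of_mem_Ksp hk)) hgb

theorem rpow_neg_half_mul_sqrt {m : ℕ} (hm : 0 < m) : (m : ℝ) ^ (-(1 : ℝ) / 2) * √m = 1 := by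
  have hm' : (0 : ℝ) < m := by exact_mod_cast hm
  rw [Real.sqrt_eq_rpow, ← Real.rpow_add hm']
  norm_num

theorem exists_abs_entry_le_of_mem_Sball (g : Matrix (Fin 4) (Fin 4) ℝ) :
    ∃ K : ℝ, 1 ≤ K ∧ ∀ m : ℕ, 0 < m → ∀ δ ≤ (1 : ℝ), ∀ γ ∈ Sball g δ m, ∀ i j,
      |(γ i j : ℝ)| ≤ K * √m := by
  obtain ⟨A, hA, h⟩ := exists_abs_conj_entry_le g
  refine ⟨A + 1, by linarith, fun m hm δ hδ γ hγ i j => ?_⟩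
  obtain ⟨-, k, hk, hclose⟩ := hγ
  have h1 : |(m : ℝ) ^ (-(1 : ℝ) / 2) * γ i j| ≤ A + 1 := by
    have := abs_add_le_of_le (h k hk i j) ((hclose i j).trans hδ)
    simpa using this
  have h2 : (γ i j : ℝ) = ((m : ℝ) ^ (-(1 : ℝ) / 2) * γ i j) * √m := by
    have := rpow_neg_half_mul_sqrt hm
    linear_combination - (γ i j : ℝ) * this
  rw [h2, abs_mul, abs_of_nonneg (Real.sqrt_nonneg _)]
  gcongr

/-- Elements of `g K g⁻¹` preserve the form `(g gᵀ)⁻¹`. -/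
theorem conj_preserves_form {g k : Matrix (Fin 4) (Fin 4) ℝ} (hg : IsUnit g.det) (hk : k ∈ Ksp) :
    (g * k * g⁻¹)ᵀ * ((g⁻¹)ᵀ * g⁻¹) * (g * k * g⁻¹) = (g⁻¹)ᵀ * g⁻¹ := by
  have h1 : g⁻¹ * (g * k * g⁻¹) = k * g⁻¹ := by
    rw [Matrix.mul_assoc g, ← Matrix.mul_assoc g⁻¹, nonsing_inv_mul g hg, Matrix.one_mul]
  have h2 : (g * k * g⁻¹)ᵀ * (g⁻¹)ᵀ = (k * g⁻¹)ᵀ := by rw [← transpose_mul, h1]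
  rw [← Matrix.mul_assoc (g * k * g⁻¹)ᵀ (g⁻¹)ᵀ g⁻¹, h2, Matrix.mul_assoc (k * g⁻¹)ᵀ, h1,
    transpose_mul, Matrix.mul_assoc, ← Matrix.mul_assoc kᵀ, hk.2, Matrix.one_mul]

theorem exists_approx_isometry (g : Matrix (Fin 4) (Fin 4) ℝ) (hg : IsUnit g.det) :
    ∃ K : ℝ, 1 ≤ K ∧ ∀ m : ℕ, 0 < m → ∀ δ, 0 ≤ δ → δ ≤ (1 : ℝ) → ∀ γ ∈ Sball g δ m, ∀ i j,
      |((γ.map (Int.cast : ℤ → ℝ))ᵀ * ((g⁻¹)ᵀ * g⁻¹) * γ.map (Int.cast : ℤ → ℝ)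
        - (m : ℝ) • ((g⁻¹)ᵀ * g⁻¹)) i j| ≤ m * (δ * K) := by
  obtain ⟨A, hA, hconj⟩ := exists_abs_conj_entry_le g
  set Q := (g⁻¹)ᵀ * g⁻¹ with hQdef
  obtain ⟨q, hq, hQ⟩ := exists_abs_entry_le Q
  refine ⟨16 * q * (2 * A + 1), by nlinarith, fun m hm δ hδ0 hδ γ hγ i j => ?_⟩
  obtain ⟨-, k, hk, hclose⟩ := hγ
  set P := g * k * g⁻¹ with hP
  have hPQ : Pᵀ * Q * P = Q := conj_preserves_form hg hk
  set s : ℝ := (m : ℝ) ^ (-(1 : ℝ) / 2) with hs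
  set X := γ.map (Int.cast : ℤ → ℝ) with hX
  have hsm : (m : ℝ) * s ^ 2 = 1 := by
    have h1 := rpow_neg_half_mul_sqrt hm
    have h2 := Real.sq_sqrt (Nat.cast_nonneg (α := ℝ) m)
    rw [← h2, ← mul_pow, mul_comm, h1, one_pow]
  set E := s • X - P with hE
  have hEb : ∀ i j, |E i j| ≤ δ := fun i j => by
    simpa [hE] using hclose i j
  have hEt : ∀ i j, |Eᵀ i j| ≤ δ := fun i j => hEb j i
  have hPb := hconj k hk
  have hPt : ∀ i j, |Pᵀ i j| ≤ A := fun i j => hPb j i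
  have hXb : ∀ i j, |(s • X) i j| ≤ A + 1 := fun i j => by
    have := abs_add_le_of_le (hPb i j) ((hEb i j).trans hδ)
    rwa [hE, Matrix.sub_apply, add_sub_cancel] at this
  have hdecomp : Xᵀ * Q * X - (m : ℝ) • Q = (m : ℝ) • (Eᵀ * Q * (s • X) + Pᵀ * Q * E) := by
    have h1 : Eᵀ * Q * (s • X) + Pᵀ * Q * E = (s • X)ᵀ * Q * (s • X) - Q := by
      rw [hE]
      simp only [transpose_sub, Matrix.sub_mul, Matrix.mul_sub]
      rw [hPQ]
      abel
    rw [h1, smul_sub]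
    congr 1
    simp only [transpose_smul, Matrix.smul_mul, Matrix.mul_smul, smul_smul]
    rw [show (m : ℝ) * (s * s) = 1 by rw [← hsm]; ring, one_smul]
  rw [hdecomp, Matrix.smul_apply, smul_eq_mul, abs_mul, Nat.abs_cast]
  gcongr
  rw [Matrix.add_apply]
  refine (abs_add_le_of_le (abs_matMul_le (abs_matMul_le hEt hQ) hXb i j)
    (abs_matMul_le (abs_matMul_le hPt hQ) hEb i j)).trans (le_of_eq ?_)
  ring

theorem abs_bilin_self_le {E : Matrix (Fin 4) (Fin 4) ℝ} {e : ℝ} (hE : ∀ i j, |E i j| ≤ e)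
    (v : Fin 4 → ℝ) : |v ⬝ᵥ E *ᵥ v| ≤ 4 * e * (v ⬝ᵥ v) := by
  have he : 0 ≤ e := (abs_nonneg _).trans (hE 0 0)
  have hterm : ∀ i j, |v i * (E i j * v j)| ≤ e * ((v i * v i + v j * v j) / 2) := by
    intro i j
    have h1 : |v i * (E i j * v j)| = |E i j| * (|v i| * |v j|) := by
      rw [abs_mul, abs_mul]; ring
    rw [h1]
    refine mul_le_mul (hE i j) ?_ (by positivity) he
    nlinarith [sq_nonneg (|v i| - |v j|), abs_mul_abs_self (v i), abs_mul_abs_self (v j)]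
  have h2 : v ⬝ᵥ E *ᵥ v = ∑ i, ∑ j, v i * (E i j * v j) := by
    simp only [dotProduct, mulVec, Finset.mul_sum]
  rw [h2]
  calc _ ≤ ∑ i, ∑ j, |v i * (E i j * v j)| :=
        (Finset.abs_sum_le_sum_abs _ _).trans
          (Finset.sum_le_sum fun i _ => Finset.abs_sum_le_sum_abs _ _)
    _ ≤ ∑ i, ∑ j, e * ((v i * v i + v j * v j) / 2) :=
        Finset.sum_le_sum fun i _ => Finset.sum_le_sum fun j _ => hterm i j
    _ = 4 * e * (v ⬝ᵥ v) := by
        simp only [dotProduct, Fin.sum_univ_four]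
        ring

theorem exists_dotProduct_self_le (g : Matrix (Fin 4) (Fin 4) ℝ) (hg : IsUnit g.det) :
    ∃ G : ℝ, 1 ≤ G ∧ ∀ v : Fin 4 → ℝ, v ⬝ᵥ v ≤ G * (v ⬝ᵥ ((g⁻¹)ᵀ * g⁻¹) *ᵥ v) := by
  refine ⟨1 + ∑ i, ∑ j, g i j ^ 2, ?_, fun v => ?_⟩
  · have : 0 ≤ ∑ i, ∑ j, g i j ^ 2 := by positivity
    linarith
  set w := g⁻¹ *ᵥ v with hw
  have hgw : g *ᵥ w = v := by rw [hw, mulVec_mulVec, mul_nonsing_inv g hg, one_mulVec]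
  have h1 : v ⬝ᵥ ((g⁻¹)ᵀ * g⁻¹) *ᵥ v = w ⬝ᵥ w := by
    rw [← mulVec_mulVec, dotProduct_mulVec, vecMul_transpose]
  rw [h1, ← hgw]
  have hww : 0 ≤ w ⬝ᵥ w := Finset.sum_nonneg fun i _ => mul_self_nonneg _
  have h2 : (g *ᵥ w) ⬝ᵥ (g *ᵥ w) ≤ ∑ i, (∑ j, g i j ^ 2) * (w ⬝ᵥ w) := by
    refine Finset.sum_le_sum fun i _ => ?_
    have := Finset.sum_mul_sq_le_sq_mul_sq Finset.univ (g i) w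
    simp only [dotProduct, mulVec, ← sq]
    simpa using this
  rw [← Finset.sum_mul] at h2
  linarith

/-- For `δ` smaller than a suitable power of `m`, all elements of `𝒮(g)_δ[m]` are similitudes of
one positive definite integral form of polynomially bounded height. -/
theorem exists_intPosDef_form (g : Matrix (Fin 4) (Fin 4) ℝ) (hg : IsUnit g.det) :
    ∃ c K : ℝ, 0 < c ∧ 1 ≤ K ∧ ∀ m : ℕ, 0 < m → ∀ δ : ℝ, 0 ≤ δ → δ ≤ 1 → δ * m ^ 17 ≤ c →
      ∃ U : Matrix (Fin 4) (Fin 4) ℤ, IntPosDef U ∧ (∀ i j, |(U i j : ℝ)| ≤ K * m ^ 16) ∧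
        ∀ γ ∈ Sball g δ m, γᵀ * U * γ = (m : ℤ) • U := by
  obtain ⟨K₁, hK₁, hentry⟩ := exists_abs_entry_le_of_mem_Sball g
  obtain ⟨K₂, hK₂, happrox⟩ := exists_approx_isometry g hg
  obtain ⟨G, hG, hGv⟩ := exists_dotProduct_self_le g hg
  set Q := (g⁻¹)ᵀ * g⁻¹ with hQdef
  have hQsymm : ∀ i j, Q i j = Q j i := fun i j => by
    have : Qᵀ = Q := by rw [hQdef, transpose_mul, transpose_transpose]
    conv_rhs => rw [← this]
    rfl
  obtain ⟨q₀, hq₀, hQ⟩ := exists_abs_entry_le Q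
  obtain ⟨N₀, hN₀⟩ := exists_nat_gt (4 * (16 * K₁ ^ 2 + 1) + 4 * G + 3)
  have hN₀pos : (0 : ℝ) < N₀ := by nlinarith
  refine ⟨1 / (4 * N₀ ^ 16 * K₂), N₀ ^ 16 * q₀ + 1, by positivity, ?_, ?_⟩
  · have : 0 ≤ (N₀ : ℝ) ^ 16 * q₀ := by positivity
    linarith
  intro m hm δ hδ0 hδ1 hδ
  have hm1 : (1 : ℝ) ≤ m := by exact_mod_cast hm
  have hn : 0 < N₀ * m := Nat.mul_pos (by exact_mod_cast hN₀pos) hm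
  obtain ⟨q, hq, hqle, u, hu⟩ := exists_nat_int_abs_mul_sub_le
    (fun p : Fin 4 × Fin 4 => Q p.1 p.2) hn
  have hq1 : (1 : ℝ) ≤ q := by exact_mod_cast hq
  have hqle' : (q : ℝ) ≤ N₀ ^ 16 * m ^ 16 := by
    rw [← mul_pow]
    exact_mod_cast hqle
  set e : ℝ := 1 / ((N₀ * m : ℕ) : ℝ) with he
  have hem : e * m * N₀ = 1 := by
    rw [he]
    push_cast
    field_simp
  have he0 : 0 < e := by rw [he]; positivity
  have heN : e * N₀ ≤ 1 := by
    rw [← hem]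
    have : 0 < e * N₀ := by positivity
    nlinarith
  have heG : 4 * e * G < 1 := by nlinarith
  have he2 : 2 * e < 1 := by nlinarith
  set U : Matrix (Fin 4) (Fin 4) ℤ := Matrix.of fun i j => u (i, j) with hUdef
  set E : Matrix (Fin 4) (Fin 4) ℝ := U.map (Int.cast : ℤ → ℝ) - (q : ℝ) • Q with hEdef
  have hE : ∀ i j, |E i j| ≤ e := fun i j => by
    have := hu (i, j)
    rw [abs_sub_comm] at this
    simpa [hEdef, hUdef] using this
  have hUE : U.map (Int.cast : ℤ → ℝ) = (q : ℝ) • Q + E := by rw [hEdef]; abel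
  have hUE' : ∀ i j, (U i j : ℝ) = q * Q i j + E i j := fun i j => by
    simpa using congrFun (congrFun hUE i) j
  have hsymm : U.IsSymm := by
    ext i j
    rw [transpose_apply]
    have h1 : |((U j i - U i j : ℤ) : ℝ)| < 1 := by
      push_cast
      rw [hUE', hUE', hQsymm j i]
      have := abs_sub_le_of_le (hE j i) (hE i j)
      have h2 : (q : ℝ) * Q i j + E j i - (q * Q i j + E i j) = E j i - E i j := by ring
      rw [h2]
      linarith
    have h2 : |U j i - U i j| < 1 := by exact_mod_cast h1
    linarith [Int.abs_lt_one_iff.mp h2]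
  refine ⟨U, ⟨hsymm, fun v hv => ?_⟩, fun i j => ?_, fun γ hγ => ?_⟩
  · set x : Fin 4 → ℝ := fun i => (v i : ℝ) with hx
    have hcast : ((v ⬝ᵥ U *ᵥ v : ℤ) : ℝ) = x ⬝ᵥ (U.map (Int.cast : ℤ → ℝ)) *ᵥ x := by
      simp [dotProduct, mulVec, hx]
    have hxx : 0 < x ⬝ᵥ x := by
      refine lt_of_le_of_ne (Finset.sum_nonneg fun i _ => mul_self_nonneg _) fun h => hv ?_
      have := dotProduct_self_eq_zero.mp h.symm
      ext i
      have := congrFun this i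
      simpa [hx] using this
    have h1 := hGv x
    have h2 := (abs_le.mp (abs_bilin_self_le hE x)).1
    have h3 : (0 : ℝ) < x ⬝ᵥ (U.map (Int.cast : ℤ → ℝ)) *ᵥ x := by
      rw [hUE, add_mulVec, dotProduct_add, smul_mulVec, dotProduct_smul, smul_eq_mul]
      have h4 : 0 < x ⬝ᵥ Q *ᵥ x := by
        by_contra! h
        nlinarith
      have h5 : x ⬝ᵥ Q *ᵥ x ≤ q * (x ⬝ᵥ Q *ᵥ x) := le_mul_of_one_le_left h4.le hq1
      have h6 : 4 * e * (x ⬝ᵥ x) ≤ 4 * e * G * (x ⬝ᵥ Q *ᵥ x) := by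
        rw [mul_assoc (4 * e)]
        gcongr
      have h7 : 4 * e * G * (x ⬝ᵥ Q *ᵥ x) < x ⬝ᵥ Q *ᵥ x := mul_lt_of_lt_one_left h4 heG
      linarith
    exact_mod_cast hcast ▸ h3
  · rw [hUE']
    have h1 : |(q : ℝ) * Q i j| ≤ N₀ ^ 16 * m ^ 16 * q₀ :=
      abs_mul_le_of_le (by rwa [Nat.abs_cast]) (hQ i j)
    have h2 : (1 : ℝ) ≤ (m : ℝ) ^ 16 := one_le_pow₀ hm1
    have h3 := abs_add_le_of_le h1 (hE i j)
    refine h3.trans ?_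
    linarith
  · set X := γ.map (Int.cast : ℤ → ℝ) with hX
    have hXb : ∀ i j, |X i j| ≤ K₁ * √m := fun i j => by
      simpa [hX] using hentry m hm δ hδ1 γ hγ i j
    have hXt : ∀ i j, |Xᵀ i j| ≤ K₁ * √m := fun i j => hXb j i
    have hW : (γᵀ * U * γ - (m : ℤ) • U).map (Int.cast : ℤ → ℝ)
        = Xᵀ * E * X - (m : ℝ) • E + (q : ℝ) • (Xᵀ * Q * X - (m : ℝ) • Q) := by
      have h1 : (γᵀ * U * γ - (m : ℤ) • U).map (Int.cast : ℤ → ℝ)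
          = Xᵀ * U.map (Int.cast : ℤ → ℝ) * X - (m : ℝ) • U.map (Int.cast : ℤ → ℝ) := by
        ext i j
        have h : ((m : ℤ) • U) i j = m * U i j := rfl
        simp only [Matrix.map_apply, Matrix.sub_apply, h, Matrix.smul_apply]
        simp [hX, mul_apply]
      rw [h1, hUE]
      simp only [Matrix.mul_add, Matrix.add_mul, Matrix.mul_smul, Matrix.smul_mul, smul_add,
        smul_sub, smul_smul, mul_comm (m : ℝ) (q : ℝ)]
      abel
    refine sub_eq_zero.mp ?_
    ext i j
    have h1 := congrFun (congrFun hW i) j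
    rw [Matrix.map_apply] at h1
    have hb1 : |(Xᵀ * E * X) i j| ≤ 16 * K₁ ^ 2 * (e * m) := by
      refine (abs_matMul_le (abs_matMul_le hXt hE) hXb i j).trans (le_of_eq ?_)
      have := Real.mul_self_sqrt (Nat.cast_nonneg (α := ℝ) m)
      linear_combination 16 * K₁ ^ 2 * e * this
    have hb2 : |((m : ℝ) • E) i j| ≤ m * e := by
      rw [Matrix.smul_apply, smul_eq_mul]
      exact abs_mul_le_of_le (by rw [Nat.abs_cast]) (hE i j)
    have hb3 : |((q : ℝ) • (Xᵀ * Q * X - (m : ℝ) • Q)) i j| ≤ 1 / 4 := by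
      rw [Matrix.smul_apply, smul_eq_mul]
      refine (abs_mul_le_of_le (A := N₀ ^ 16 * m ^ 16) (by rwa [Nat.abs_cast])
        (happrox m hm δ hδ0 hδ1 γ hγ i j)).trans ?_
      rw [le_div_iff₀ (by positivity)] at hδ
      linarith
    have hb12 : 16 * K₁ ^ 2 * (e * m) + m * e ≤ 1 / 4 := by
      have h4 : 4 * (16 * K₁ ^ 2 + 1) ≤ (N₀ : ℝ) := by linarith
      have h5 : 0 ≤ e * m := by positivity
      nlinarith
    have h2 : |(((γᵀ * U * γ - (m : ℤ) • U) i j : ℤ) : ℝ)| < 1 := by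
      rw [h1, Matrix.add_apply, Matrix.sub_apply]
      have := abs_add_le_of_le (abs_sub_le_of_le hb1 hb2) hb3
      linarith
    exact Int.abs_lt_one_iff.mp (by exact_mod_cast h2)

theorem finite_and_card_le_of_finset_card_le {α : Type*} {s : Set α} {b : ℝ}
    (h : ∀ T : Finset α, ↑T ⊆ s → (T.card : ℝ) ≤ b) : s.Finite ∧ (Nat.card s : ℝ) ≤ b := by
  have hfin : s.Finite := by
    by_contra hinf
    obtain ⟨n, hn⟩ := exists_nat_gt b
    obtain ⟨T, hT, hcard⟩ := Set.Infinite.exists_subset_card_eq hinf n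
    have := h T hT
    rw [hcard] at this
    linarith
  refine ⟨hfin, ?_⟩
  have := h hfin.toFinset (by simp)
  rwa [Nat.card_coe_set_eq, Set.ncard_eq_toFinset_card s hfin]

theorem card_le_of_entries_le {R : ℕ} (T : Finset (Matrix (Fin 4) (Fin 4) ℤ))
    (hT : ∀ γ ∈ T, ∀ i j, |γ i j| ≤ R) : T.card ≤ (2 * R + 1) ^ 16 := by
  let box : Finset (Fin 4 → Fin 4 → ℤ) :=
    Fintype.piFinset fun _ => Fintype.piFinset fun _ => Finset.Icc (-R : ℤ) R
  have hmaps : ∀ γ ∈ T, Matrix.of.symm γ ∈ box := by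
    intro γ hγ
    simp only [box, Fintype.mem_piFinset, Finset.mem_Icc, ← abs_le]
    exact hT γ hγ
  refine (Finset.card_le_card_of_injOn _ hmaps Matrix.of.symm.injective.injOn).trans
    (le_of_eq ?_)
  have : ((R : ℤ) + 1 - -R).toNat = 2 * R + 1 := by omega
  simp only [box, Fintype.card_piFinset, Int.card_Icc, this, Finset.prod_const, Finset.card_univ,
    Fintype.card_fin]
  ring

theorem mem_Smat_iff {m : ℕ} {γ : Matrix (Fin 4) (Fin 4) ℤ} :
    γ ∈ Smat m ↔ γᵀ * JmatInt * γ = (m : ℤ) • JmatInt := by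
  have hinj : Function.Injective (fun X : Matrix (Fin 4) (Fin 4) ℤ => X.map (Int.cast : ℤ → ℝ)) :=
    Matrix.map_injective Int.cast_injective
  change _ = _ ↔ _
  rw [← hinj.eq_iff, ← JmatInt_map]
  have h1 : (γᵀ * JmatInt * γ).map (Int.cast : ℤ → ℝ) = (γ.map (Int.cast : ℤ → ℝ))ᵀ *
      JmatInt.map (Int.cast : ℤ → ℝ) * γ.map (Int.cast : ℤ → ℝ) := by
    ext i j
    simp [mul_apply]
  have h2 : ((m : ℤ) • JmatInt).map (Int.cast : ℤ → ℝ) =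
      (m : ℝ) • JmatInt.map (Int.cast : ℤ → ℝ) := by
    ext i j
    have h : ((m : ℤ) • JmatInt) i j = m * JmatInt i j := rfl
    simp only [Matrix.map_apply, h, Matrix.smul_apply]
    simp
  rw [h1, h2]

theorem counting_bound :
    ∃ η : ℝ, 0 < η ∧ ∃ B : ℝ, 0 < B ∧
      ∀ g ∈ Sp4, ∀ ε : ℝ, 0 < ε → ∃ C : ℝ, 0 < C ∧
        ∀ m : ℕ, 0 < m → ∀ δ : ℝ, 0 < δ → δ ≤ 1 →
          (Sball g δ m).Finite ∧
          (Nat.card (Sball g δ m) : ℝ) ≤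
            C * (m : ℝ) ^ (1 + ε) * (1 + δ ^ η * (m : ℝ) ^ B) := by
  refine ⟨1, one_pos, 33, by norm_num, fun g hg ε hε => ?_⟩
  have hdet := isUnit_det_of_mem_Sp4 hg
  obtain ⟨K, hK, hentry⟩ := exists_abs_entry_le_of_mem_Sball g
  obtain ⟨c, L, hc, hL, hform⟩ := exists_intPosDef_form g hdet
  obtain ⟨C, hC, hcount⟩ := exists_card_similitudes_le (ε := ε / (16 : ℕ)) (by positivity)
  set C₁ : ℝ := C * (L + K) ^ (ε / (16 : ℕ)) * (3 * K) ^ 2 with hC₁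
  set C₂ : ℝ := (3 * K) ^ 16 / c with hC₂
  have hC₁0 : 0 < C₁ := by positivity
  have hC₂0 : 0 < C₂ := by positivity
  refine ⟨C₁ + C₂, by positivity, fun m hm δ hδ0 hδ1 => ?_⟩
  have hm1 : (1 : ℝ) ≤ m := by exact_mod_cast hm
  have hm0 : (0 : ℝ) < m := by linarith
  have hsqrt1 : 1 ≤ √(m : ℝ) := Real.one_le_sqrt.mpr hm1
  have hsqrt : √(m : ℝ) ≤ m := by
    nlinarith [Real.sq_sqrt (Nat.cast_nonneg (α := ℝ) m)]
  have hmpow : (1 : ℝ) ≤ (m : ℝ) ^ (1 + ε) := Real.one_le_rpow hm1 (by linarith)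
  have hB : δ ^ (1 : ℝ) * (m : ℝ) ^ (33 : ℝ) = δ * (m : ℝ) ^ 33 := by
    rw [Real.rpow_one]
    norm_cast
  rw [hB]
  refine finite_and_card_le_of_finset_card_le fun T hT => ?_
  set R : ℕ := ⌊K * √(m : ℝ)⌋₊ with hR
  have hRle : (R : ℝ) ≤ K * √(m : ℝ) := Nat.floor_le (by positivity)
  have hR3 : 2 * (R : ℝ) + 1 ≤ 3 * K * √(m : ℝ) := by nlinarith
  have hTR : ∀ γ ∈ T, ∀ i j, |γ i j| ≤ R := by
    intro γ hγ i j
    have h1 := hentry m hm δ hδ1 γ (hT hγ) i j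
    have h2 : ((γ i j).natAbs : ℝ) ≤ K * √(m : ℝ) := by
      rwa [Nat.cast_natAbs, Int.cast_abs]
    have h3 := Nat.le_floor h2
    rw [Int.abs_eq_natAbs]
    exact_mod_cast h3
  rcases le_or_gt (δ * (m : ℝ) ^ 17) c with hδ | hδ
  · obtain ⟨U, hU, hUb, hUγ⟩ := hform m hm δ hδ0.le hδ1 hδ
    have h16 : (m : ℝ) ≤ (m : ℝ) ^ 16 := le_self_pow₀ hm1 (by norm_num)
    have h16' : (1 : ℝ) ≤ (m : ℝ) ^ 16 := hm1.trans h16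
    have hcard := hcount U m ((L + K) * m ^ 16) R (by nlinarith)
      (fun i j => (hUb i j).trans (by nlinarith)) (by
        rw [Int.cast_natCast, Nat.abs_cast]
        nlinarith) (by nlinarith) (by exact_mod_cast hm) hU T
      (fun γ hγ => ⟨hUγ γ (hT hγ), mem_Smat_iff.mp (hT hγ).1, hTR γ hγ⟩)
    rw [rpow_const_mul_pow (by norm_num) (by positivity) hm0.le] at hcard
    have hR2 : (2 * (R : ℝ) + 1) ^ 2 ≤ (3 * K) ^ 2 * m := by
      refine (pow_le_pow_left₀ (by positivity) hR3 2).trans (le_of_eq ?_)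
      rw [mul_pow, Real.sq_sqrt hm0.le]
    calc (T.card : ℝ) ≤ C * ((L + K) ^ (ε / (16 : ℕ)) * (m : ℝ) ^ ε) * ((3 * K) ^ 2 * m) :=
          hcard.trans (by gcongr)
      _ = C₁ * (m : ℝ) ^ (1 + ε) * 1 := by
          rw [hC₁, Real.rpow_add hm0, Real.rpow_one]
          ring
      _ ≤ (C₁ + C₂) * (m : ℝ) ^ (1 + ε) * (1 + δ * (m : ℝ) ^ 33) := by
          gcongr
          · linarith
          · have : 0 ≤ δ * (m : ℝ) ^ 33 := by positivity
            linarith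
  · have h1 : (T.card : ℝ) ≤ (2 * R + 1) ^ 16 := by exact_mod_cast card_le_of_entries_le T hTR
    have h2 : 2 * (R : ℝ) + 1 ≤ 3 * K * m := hR3.trans (by gcongr)
    calc (T.card : ℝ) ≤ (3 * K * m) ^ 16 := h1.trans (by gcongr)
      _ = C₂ * 1 * (c * (m : ℝ) ^ 16) := by
          rw [hC₂]
          field_simp
      _ ≤ C₂ * 1 * (δ * (m : ℝ) ^ 17 * (m : ℝ) ^ 16) := by gcongr
      _ = C₂ * 1 * (δ * (m : ℝ) ^ 33) := by ring
      _ ≤ (C₁ + C₂) * (m : ℝ) ^ (1 + ε) * (1 + δ * (m : ℝ) ^ 33) := by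
          gcongr
          · linarith
          · linarith
end
end

section
/- For every g ∈ Sp₄(ℝ) there is a constant C = C(g) > 0 such that for every positive integer m, every real δ with 0 < δ ≤ 1, and any two matrices γ, γ' ∈ 𝒮(g)_δ[m] whose first two columns agree (γ_{i1} = γ'_{i1} and γ_{i2} = γ'_{i2} for all 1 ≤ i ≤ 4), all remaining entries agree up to the stated error: |γ_{ij} − γ'_{ij}| ≤ C · δ · m^(1/2) for all 1 ≤ i,j ≤ 4. -/
open Matrix

noncomputable section

/-- A linear endomorphism of the space of matrices is bounded for the entrywise sup norm. -/
theorem exists_entry_bound_of_linearMap {n : Type*} [Fintype n]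
    (L : Matrix n n ℝ →ₗ[ℝ] Matrix n n ℝ) :
    ∃ C : ℝ, 0 < C ∧ ∀ (F : Matrix n n ℝ) (r : ℝ), 0 ≤ r → (∀ i j, |F i j| ≤ r) →
      ∀ i j, |L F i j| ≤ C * r := by
  let Φ : (n → n → ℝ) →L[ℝ] (n → n → ℝ) :=
    LinearMap.toContinuousLinearMap (show (n → n → ℝ) →ₗ[ℝ] (n → n → ℝ) from L)
  refine ⟨‖Φ‖ + 1, by positivity, fun F r hr hF i j => ?_⟩
  let f : n → n → ℝ := F
  have hFr : ‖f‖ ≤ r :=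
    (pi_norm_le_iff_of_nonneg hr).2 fun i => (pi_norm_le_iff_of_nonneg hr).2 fun j => hF i j
  calc |L F i j| ≤ ‖Φ f‖ := (norm_le_pi_norm (Φ f i) j).trans (norm_le_pi_norm (Φ f) i)
    _ ≤ ‖Φ‖ * ‖f‖ := Φ.le_opNorm f
    _ ≤ (‖Φ‖ + 1) * r := by gcongr; linarith

theorem Jmat_commute_of_mem_Ksp {k : Matrix (Fin 4) (Fin 4) ℝ} (hk : k ∈ Ksp) :
    Jmat * k = k * Jmat := by
  obtain ⟨hs, ho⟩ := hk
  have hs' : kᵀ * Jmat * k = Jmat := hs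
  have ho' : k * kᵀ = 1 := mul_eq_one_comm.1 ho
  calc Jmat * k = (k * kᵀ) * (Jmat * k) := by rw [ho', one_mul]
    _ = k * (kᵀ * Jmat * k) := by noncomm_ring
    _ = k * Jmat := by rw [hs']

/-- The projection onto the span of the first two coordinate vectors. -/
def projFirstTwo : Matrix (Fin 4) (Fin 4) ℝ := Matrix.diagonal ![1, 1, 0, 0]

theorem mul_projFirstTwo_apply (E : Matrix (Fin 4) (Fin 4) ℝ) (i j : Fin 4) :
    (E * projFirstTwo) i j = E i j * (![1, 1, 0, 0] : Fin 4 → ℝ) j := by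
  simp [projFirstTwo]

theorem Jmat_mul_projFirstTwo_mul_Jmat :
    Jmat * projFirstTwo * Jmat = projFirstTwo - 1 := by
  have h : projFirstTwo = !![1, 0, 0, 0; 0, 1, 0, 0; 0, 0, 0, 0; 0, 0, 0, 0] := by
    ext i j
    fin_cases i <;> fin_cases j <;> simp [projFirstTwo]
  rw [h]
  ext i j
  fin_cases i <;> fin_cases j <;> simp [Jmat, Matrix.mul_apply, Fin.sum_univ_four]

theorem conj_Jmat_eq {g : Matrix (Fin 4) (Fin 4) ℝ} (hg : g ∈ Sp4) :
    g * Jmat * g⁻¹ = g * gᵀ * Jmat := by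
  have hg' : gᵀ * Jmat * g = Jmat := hg
  have hu := isUnit_det_of_mem_Sp4 hg
  calc g * Jmat * g⁻¹ = g * (gᵀ * Jmat * g) * g⁻¹ := by rw [hg']
    _ = g * gᵀ * Jmat * (g * g⁻¹) := by noncomm_ring
    _ = g * gᵀ * Jmat := by rw [Matrix.mul_nonsing_inv g hu, mul_one]

/-- The first two coordinate vectors together with their images under the complex structure
`g J g⁻¹` form a basis. -/
theorem isUnit_det_basis_change {g : Matrix (Fin 4) (Fin 4) ℝ} (hg : g ∈ Sp4) :
    IsUnit (projFirstTwo + g * Jmat * g⁻¹ * projFirstTwo * Jmat).det := by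
  have hT : projFirstTwo + g * Jmat * g⁻¹ * projFirstTwo * Jmat
      = projFirstTwo - g * gᵀ * (1 - projFirstTwo) := by
    calc _ = projFirstTwo + g * gᵀ * (Jmat * projFirstTwo * Jmat) := by
          rw [conj_Jmat_eq hg]; noncomm_ring
      _ = _ := by rw [Jmat_mul_projFirstTwo_mul_Jmat]; noncomm_ring
  rw [hT, isUnit_iff_ne_zero]
  intro h0
  obtain ⟨v, hv, hTv⟩ := Matrix.exists_mulVec_eq_zero_iff.2 h0
  set w := (1 - projFirstTwo) *ᵥ v with hw
  have hPw : projFirstTwo *ᵥ v = g *ᵥ (gᵀ *ᵥ w) := by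
    rw [Matrix.sub_mulVec, ← Matrix.mulVec_mulVec, ← hw, sub_eq_zero] at hTv
    exact hTv.trans (Matrix.mulVec_mulVec w g gᵀ).symm
  have horth : w ⬝ᵥ (projFirstTwo *ᵥ v) = 0 := by
    simp [hw, Matrix.sub_mulVec, projFirstTwo, Matrix.mulVec_diagonal, dotProduct,
      Fin.sum_univ_four]
  have hgw : gᵀ *ᵥ w = 0 := by
    rw [hPw, Matrix.dotProduct_mulVec, ← Matrix.mulVec_transpose] at horth
    exact dotProduct_self_eq_zero.1 horth
  have hv' : v = w + projFirstTwo *ᵥ v := by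
    rw [hw, Matrix.sub_mulVec, Matrix.one_mulVec, sub_add_cancel]
  have hw0 : w = 0 := by
    refine Matrix.eq_zero_of_mulVec_eq_zero ?_ hgw
    rw [Matrix.det_transpose]
    exact (isUnit_det_of_mem_Sp4 hg).ne_zero
  apply hv
  rw [hv', hPw, hgw, hw0, Matrix.mulVec_zero, add_zero]

/-- The entries of a matrix commuting with `g J g⁻¹` are controlled by its first two columns. -/
theorem exists_entry_bound_of_commute {g : Matrix (Fin 4) (Fin 4) ℝ} (hg : g ∈ Sp4) :
    ∃ C : ℝ, 0 < C ∧ ∀ E : Matrix (Fin 4) (Fin 4) ℝ,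
      g * Jmat * g⁻¹ * E = E * (g * Jmat * g⁻¹) →
      ∀ r : ℝ, 0 ≤ r → (∀ i, |E i 0| ≤ r) → (∀ i, |E i 1| ≤ r) →
        ∀ i j, |E i j| ≤ C * r := by
  set A := g * Jmat * g⁻¹
  set T := projFirstTwo + A * projFirstTwo * Jmat with hT
  obtain ⟨C, hC, hb⟩ := exists_entry_bound_of_linearMap
    ((LinearMap.mulRight ℝ T⁻¹) ∘ₗ
      (LinearMap.id + LinearMap.mulLeft ℝ A ∘ₗ LinearMap.mulRight ℝ Jmat))
  refine ⟨C, hC, fun E hE r hr h0 h1 => ?_⟩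
  have hEF : (E * projFirstTwo + A * (E * projFirstTwo * Jmat)) * T⁻¹ = E := by
    have h : E * projFirstTwo + A * (E * projFirstTwo * Jmat) = E * T := by
      calc _ = E * projFirstTwo + (A * E) * (projFirstTwo * Jmat) := by noncomm_ring
        _ = E * T := by rw [hE, hT]; noncomm_ring
    rw [h, Matrix.mul_assoc, Matrix.mul_nonsing_inv T (isUnit_det_basis_change hg), mul_one]
  have hF : ∀ i j, |(E * projFirstTwo) i j| ≤ r := by
    intro i j
    rw [mul_projFirstTwo_apply]
    fin_cases j <;> simp [h0, h1, hr]
  intro i j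
  have := hb _ r hr hF i j
  simp only [LinearMap.comp_apply, LinearMap.add_apply, LinearMap.id_apply,
    LinearMap.mulLeft_apply, LinearMap.mulRight_apply] at this
  rwa [hEF] at this

theorem first_two_columns_determine :
    ∀ g ∈ Sp4, ∃ C : ℝ, 0 < C ∧
      ∀ m : ℕ, 0 < m → ∀ δ : ℝ, 0 < δ → δ ≤ 1 →
        ∀ γ ∈ Sball g δ m, ∀ γ' ∈ Sball g δ m,
          (∀ i : Fin 4, γ i 0 = γ' i 0) → (∀ i : Fin 4, γ i 1 = γ' i 1) →
            ∀ i j : Fin 4, |(γ i j : ℝ) - (γ' i j : ℝ)| ≤ C * δ * Real.sqrt m := by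
  intro g hg
  obtain ⟨C, hC, hb⟩ := exists_entry_bound_of_commute hg
  refine ⟨2 * C + 2, by positivity, ?_⟩
  rintro m hm δ hδ - γ ⟨-, k, hk, hγ⟩ γ' ⟨-, k', hk', hγ'⟩ h0 h1
  have hu := isUnit_det_of_mem_Sp4 hg
  have hcomm : ∀ k ∈ Ksp, g * Jmat * g⁻¹ * (g * k * g⁻¹) = g * k * g⁻¹ * (g * Jmat * g⁻¹) := by
    intro k hk
    calc _ = g * Jmat * (g⁻¹ * g) * k * g⁻¹ := by noncomm_ring
      _ = g * (Jmat * k) * g⁻¹ := by rw [Matrix.nonsing_inv_mul g hu]; noncomm_ring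
      _ = g * k * 1 * Jmat * g⁻¹ := by rw [Jmat_commute_of_mem_Ksp hk]; noncomm_ring
      _ = _ := by rw [← Matrix.nonsing_inv_mul g hu]; noncomm_ring
  set s := (m : ℝ) ^ (-(1 : ℝ) / 2)
  have hs : s * √m = 1 := by
    rw [Real.sqrt_eq_rpow, ← Real.rpow_add (by positivity)]
    norm_num
  have hclose : ∀ i j, |(s * γ i j - s * γ' i j) - (g * k * g⁻¹ - g * k' * g⁻¹) i j| ≤ 2 * δ := by
    intro i j
    have a := abs_le.1 (hγ i j)
    have b := abs_le.1 (hγ' i j)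
    simp only [Matrix.map_apply] at a b
    rw [Matrix.sub_apply, abs_le]
    constructor <;> linarith [a.1, a.2, b.1, b.2]
  have hE := hb (g * k * g⁻¹ - g * k' * g⁻¹)
    (by rw [mul_sub, sub_mul, hcomm k hk, hcomm k' hk']) (2 * δ) (by positivity)
    (fun i => by simpa [h0 i, abs_sub_comm] using hclose i 0)
    (fun i => by simpa [h1 i, abs_sub_comm] using hclose i 1)
  intro i j
  have hscaled : |s * γ i j - s * γ' i j| ≤ (2 * C + 2) * δ := by
    have a := abs_le.1 (hE i j)
    have b := abs_le.1 (hclose i j)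
    rw [abs_le]
    constructor <;> linarith [a.1, a.2, b.1, b.2]
  calc |(γ i j : ℝ) - γ' i j| = |(s * γ i j - s * γ' i j) * √m| := by
        congr 1
        linear_combination (-((γ i j : ℝ) - γ' i j)) * hs
    _ = |s * γ i j - s * γ' i j| * √m := by rw [abs_mul, abs_of_nonneg (Real.sqrt_nonneg _)]
    _ ≤ (2 * C + 2) * δ * √m := by gcongr
end
end

section
/- For every g ∈ Sp₄(ℝ) there is a constant C = C(g) > 0 such that for every positive integer m, every real δ with 0 < δ ≤ 1, and every γ ∈ 𝒮(g)_δ[m], setting Q = (g·gᵀ)^{−1}, every entry of the matrix γᵀ Q γ − m·Q has absolute value at most C · δ · m. In particular, the first column r and second column s of γ satisfy |rᵀ Q r − m·q₁₁| ≤ C δ m, |sᵀ Q s − m·q₂₂| ≤ C δ m, and |rᵀ Q s − m·q₁₂| ≤ C δ m, where q_{ij} are the entries of Q. -/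
open Matrix

noncomputable section

theorem abs_mul_apply_le {n : Type*} [Fintype n] {A B : Matrix n n ℝ} {a b : ℝ}
    (hA : ∀ i j, |A i j| ≤ a) (hB : ∀ i j, |B i j| ≤ b) (i j : n) :
    |(A * B) i j| ≤ Fintype.card n * (a * b) := by
  rw [Matrix.mul_apply]
  refine (Finset.abs_sum_le_sum_abs _ _).trans ?_
  calc ∑ l, |A i l * B l j| ≤ ∑ _l : n, a * b := by
        refine Finset.sum_le_sum fun l _ => ?_
        rw [abs_mul]
        exact mul_le_mul (hA i l) (hB l j) (abs_nonneg _) ((abs_nonneg _).trans (hA i l))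
    _ = Fintype.card n * (a * b) := by simp

theorem exists_forall_abs_apply_le {n : Type*} [Finite n] (A : Matrix n n ℝ) :
    ∃ a : ℝ, 0 ≤ a ∧ ∀ i j, |A i j| ≤ a := by
  have := Fintype.ofFinite n
  refine ⟨∑ i, ∑ j, |A i j|, by positivity, fun i j => ?_⟩
  calc |A i j| ≤ ∑ j, |A i j| :=
        Finset.single_le_sum (f := fun j => |A i j|) (fun _ _ => abs_nonneg _)
          (Finset.mem_univ j)
    _ ≤ ∑ i, ∑ j, |A i j| :=
        Finset.single_le_sum (f := fun i => ∑ j, |A i j|) (fun _ _ => by positivity)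
          (Finset.mem_univ i)

/-- Conjugates `g k g⁻¹` of orthogonal matrices preserve the quadratic form `(g gᵀ)⁻¹`. -/
theorem conj_transpose_mul_inv_mul_conj {n : Type*} [Fintype n] [DecidableEq n]
    {g k : Matrix n n ℝ} (hg : IsUnit g.det) (hk : kᵀ * k = 1) :
    (g * k * g⁻¹)ᵀ * (g * gᵀ)⁻¹ * (g * k * g⁻¹) = (g * gᵀ)⁻¹ := by
  have hgt : IsUnit gᵀ.det := by rwa [Matrix.det_transpose]
  rw [Matrix.mul_inv_rev, Matrix.transpose_mul, Matrix.transpose_mul, Matrix.transpose_nonsing_inv]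
  calc gᵀ⁻¹ * (kᵀ * gᵀ) * (gᵀ⁻¹ * g⁻¹) * (g * k * g⁻¹)
      = gᵀ⁻¹ * (kᵀ * (gᵀ * gᵀ⁻¹) * (g⁻¹ * g) * k) * g⁻¹ := by simp only [Matrix.mul_assoc]
    _ = gᵀ⁻¹ * g⁻¹ := by
        rw [Matrix.mul_nonsing_inv _ hgt, Matrix.nonsing_inv_mul _ hg, Matrix.mul_one,
          Matrix.mul_one, hk, Matrix.mul_one]

theorem abs_transpose_mul_mul_sub_apply_le {n : Type*} [Fintype n]
    {A B Q : Matrix n n ℝ} {b q δ : ℝ} (hδ : 0 ≤ δ) (hδ' : δ ≤ 1) (hq : 0 ≤ q)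
    (hB : ∀ i j, |B i j| ≤ b) (hQ : ∀ i j, |Q i j| ≤ q)
    (hAB : ∀ i j, |A i j - B i j| ≤ δ) (i j : n) :
    |(Aᵀ * Q * A - Bᵀ * Q * B) i j| ≤ (Fintype.card n : ℝ) ^ 2 * q * (2 * b + 1) * δ := by
  have hE : ∀ i j, |(A - B) i j| ≤ δ := hAB
  have hEt : ∀ i j, |(A - B)ᵀ i j| ≤ δ := fun i j => hAB j i
  have hBt : ∀ i j, |Bᵀ i j| ≤ b := fun i j => hB j i
  have h₁ := abs_mul_apply_le (abs_mul_apply_le hEt hQ) hB i j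
  have h₂ := abs_mul_apply_le (abs_mul_apply_le hBt hQ) hE i j
  have h₃ := abs_mul_apply_le (abs_mul_apply_le hEt hQ) hE i j
  have hsplit : Aᵀ * Q * A - Bᵀ * Q * B =
      (A - B)ᵀ * Q * B + Bᵀ * Q * (A - B) + (A - B)ᵀ * Q * (A - B) := by
    rw [Matrix.transpose_sub]
    noncomm_ring
  rw [hsplit, Matrix.add_apply, Matrix.add_apply]
  refine (abs_add_three _ _ _).trans ?_
  have hsq : (Fintype.card n : ℝ) ^ 2 * q * (δ * δ) ≤ (Fintype.card n : ℝ) ^ 2 * q * δ := by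
    gcongr
    exact mul_le_of_le_one_left hδ hδ'
  linear_combination h₁ + h₂ + h₃ + hsq

theorem abs_apply_le_one_of_transpose_mul_self {n : Type*} [Fintype n] [DecidableEq n]
    {k : Matrix n n ℝ} (hk : kᵀ * k = 1) (i j : n) : |k i j| ≤ 1 :=
  entry_norm_bound_of_unitary (Matrix.mem_orthogonalGroup_iff' n ℝ |>.2 hk) i j

theorem transpose_mul_mul_apply_s3 {n : Type*} [Fintype n] (M Q : Matrix n n ℝ) (i j : n) :
    (Mᵀ * Q * M) i j = (fun a => M a i) ⬝ᵥ Q.mulVec (fun a => M a j) := by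
  rw [Matrix.mul_assoc]
  rfl

theorem quadratic_relations :
    ∀ g ∈ Sp4, ∃ C : ℝ, 0 < C ∧
      ∀ m : ℕ, 0 < m → ∀ δ : ℝ, 0 < δ → δ ≤ 1 →
        ∀ γ ∈ Sball g δ m,
          ((∀ i j : Fin 4,
            |((γ.map (Int.cast : ℤ → ℝ))ᵀ * (g * gᵀ)⁻¹ * (γ.map (Int.cast : ℤ → ℝ))
              - (m : ℝ) • (g * gᵀ)⁻¹) i j| ≤ C * δ * m) ∧
          |(fun i => (γ i 0 : ℝ)) ⬝ᵥ ((g * gᵀ)⁻¹).mulVec (fun i => (γ i 0 : ℝ))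
            - (m : ℝ) * ((g * gᵀ)⁻¹ 0 0)| ≤ C * δ * m ∧
          |(fun i => (γ i 1 : ℝ)) ⬝ᵥ ((g * gᵀ)⁻¹).mulVec (fun i => (γ i 1 : ℝ))
            - (m : ℝ) * ((g * gᵀ)⁻¹ 1 1)| ≤ C * δ * m ∧
          |(fun i => (γ i 0 : ℝ)) ⬝ᵥ ((g * gᵀ)⁻¹).mulVec (fun i => (γ i 1 : ℝ))
            - (m : ℝ) * ((g * gᵀ)⁻¹ 0 1)| ≤ C * δ * m) := by
  intro g hg
  have hdet := isUnit_det_of_mem_Sp4 hg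
  obtain ⟨a, ha, hga⟩ := exists_forall_abs_apply_le g
  obtain ⟨b, hb, hgb⟩ := exists_forall_abs_apply_le g⁻¹
  obtain ⟨q, hq, hQ⟩ := exists_forall_abs_apply_le (g * gᵀ)⁻¹
  let c : ℝ := Fintype.card (Fin 4)
  have hc : 0 ≤ c := Nat.cast_nonneg _
  refine ⟨c ^ 2 * q * (2 * (c * (c * (a * 1) * b)) + 1) + 1, by positivity, ?_⟩
  intro m hm δ hδ hδ' γ ⟨_, k, ⟨_, hk⟩, hγ⟩
  have key : ∀ i j : Fin 4,
      |((γ.map (Int.cast : ℤ → ℝ))ᵀ * (g * gᵀ)⁻¹ * (γ.map (Int.cast : ℤ → ℝ))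
        - (m : ℝ) • (g * gᵀ)⁻¹) i j| ≤
        (c ^ 2 * q * (2 * (c * (c * (a * 1) * b)) + 1) + 1) * δ * m := by
    intro i j
    have hm' : (0 : ℝ) < m := Nat.cast_pos.2 hm
    set G := γ.map (Int.cast : ℤ → ℝ)
    set s : ℝ := (m : ℝ) ^ (-(1 : ℝ) / 2)
    have hs : m * s * s = 1 := by
      rw [mul_assoc, ← Real.rpow_add hm']
      norm_num [Real.rpow_neg_one, hm'.ne']
    have hbd := abs_transpose_mul_mul_sub_apply_le (A := s • G) hδ.le hδ' hq
      (abs_mul_apply_le (abs_mul_apply_le hga (abs_apply_le_one_of_transpose_mul_self hk)) hgb)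
      hQ hγ i j
    rw [conj_transpose_mul_inv_mul_conj hdet hk] at hbd
    have hscale : Gᵀ * (g * gᵀ)⁻¹ * G - (m : ℝ) • (g * gᵀ)⁻¹ =
        (m : ℝ) • ((s • G)ᵀ * (g * gᵀ)⁻¹ * (s • G) - (g * gᵀ)⁻¹) := by
      rw [Matrix.transpose_smul, Matrix.smul_mul, Matrix.smul_mul, Matrix.mul_smul, smul_sub,
        smul_smul, smul_smul, hs, one_smul]
    rw [hscale, Matrix.smul_apply, smul_eq_mul, abs_mul, abs_of_pos hm', mul_comm]
    refine mul_le_mul_of_nonneg_right (hbd.trans ?_) hm'.le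
    exact mul_le_mul_of_nonneg_right (le_add_of_nonneg_right zero_le_one) hδ.le
  have entry (i j : Fin 4) := key i j
  simp only [Matrix.sub_apply, Matrix.smul_apply, smul_eq_mul, transpose_mul_mul_apply_s3,
    Matrix.map_apply] at entry
  exact ⟨key, entry 0 0, entry 1 1, entry 0 1⟩
end
end
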